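/- arXiv:2304.05602 — 3 statements merged into one kernel-verified Lean document; each statement's English description precedes it below -/
import Mathlib

section
/- Let H = (H_p)_{p in G} be a G-cograded Hopf coquasigroup and let R = (R_p) with R_p = H_p[y_p; τ_p, δ_p] be a group-cograded Hopf coquasigroup-Ore extension of H whose comultiplication satisfies Δ_{p,q}(y_{pq}) = y_p ⊗ 1_q + r_p ⊗ y_q for a family of elements r_p in H_p. Then the antipode of R satisfies S_{p⁻¹}(y_{p⁻¹}) = −S_{p⁻¹}(r_{p⁻¹})·y_p for every p in G. -/
open scoped TensorProduct

section Preliminaries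

variable (k : Type*) [Field k] {G : Type*} [Group G]

/-- Transport along an equality of group indices, as a `k`-linear map. -/
def lcast {H : G → Type*} [∀ p, AddCommMonoid (H p)] [∀ p, Module k (H p)]
    {p q : G} (e : p = q) : H p →ₗ[k] H q where
  toFun h := e ▸ h
  map_add' := by subst e; intros; rfl
  map_smul' := by subst e; intros; rfl

/-- A `G`-cograded Hopf coquasigroup over the field `k`. -/
structure GCHCQG (H : G → Type*) [∀ p, Ring (H p)] [∀ p, Algebra k (H p)] where
  /-- the comultiplication, a family of algebra maps `Δ_{p,q} : H_{pq} → H_p ⊗ H_q` -/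
  Δ : ∀ p q : G, H (p * q) →ₐ[k] (H p ⊗[k] H q)
  /-- the counit -/
  ε : H 1 →ₐ[k] k
  /-- the antipode, a family of `k`-linear anti-homomorphisms `S_p : H_p → H_{p⁻¹}` -/
  S : ∀ p : G, H p →ₗ[k] H p⁻¹
  S_one : ∀ p : G, S p (1 : H p) = 1
  S_mul : ∀ (p : G) (a b : H p), S p (a * b) = S p b * S p a
  /-- `(ε ⊗ id)Δ_{1,p} = id` -/
  counit_left : ∀ (p : G) (h : H (1 * p)),
    TensorProduct.lid k (H p)
      (TensorProduct.map ε.toLinearMap LinearMap.id (Δ 1 p h))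
      = lcast k (one_mul p) h
  /-- `(id ⊗ ε)Δ_{p,1} = id` -/
  counit_right : ∀ (p : G) (h : H (p * 1)),
    TensorProduct.rid k (H p)
      (TensorProduct.map LinearMap.id ε.toLinearMap (Δ p 1 h))
      = lcast k (mul_one p) h
  /-- `S_{q⁻¹}(h_(1,q⁻¹))h_(21,q) ⊗ h_(22,p) = 1_q ⊗ h` -/
  antipode_1 : ∀ (p q : G) (h : H (q⁻¹ * (q * p))),
    TensorProduct.map (LinearMap.mul' k (H q)) LinearMap.id
      (TensorProduct.map
        (TensorProduct.map ((lcast k (inv_inv q)).comp (S q⁻¹)) LinearMap.id)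
        LinearMap.id
        ((TensorProduct.assoc k (H q⁻¹) (H q) (H p)).symm
          (TensorProduct.map LinearMap.id (Δ q p).toLinearMap
            (Δ q⁻¹ (q * p) h))))
      = (1 : H q) ⊗ₜ[k] lcast k (inv_mul_cancel_left q p) h
  /-- `h_(1,q)S_{q⁻¹}(h_(21,q⁻¹)) ⊗ h_(22,p) = 1_q ⊗ h` -/
  antipode_2 : ∀ (p q : G) (h : H (q * (q⁻¹ * p))),
    TensorProduct.map (LinearMap.mul' k (H q)) LinearMap.id
      (TensorProduct.map
        (TensorProduct.map LinearMap.id ((lcast k (inv_inv q)).comp (S q⁻¹)))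
        LinearMap.id
        ((TensorProduct.assoc k (H q) (H q⁻¹) (H p)).symm
          (TensorProduct.map LinearMap.id (Δ q⁻¹ p).toLinearMap
            (Δ q (q⁻¹ * p) h))))
      = (1 : H q) ⊗ₜ[k] lcast k (mul_inv_cancel_left q p) h
  /-- `h_(11,p) ⊗ h_(12,q)S_{q⁻¹}(h_(2,q⁻¹)) = h ⊗ 1_q` -/
  antipode_3 : ∀ (p q : G) (h : H ((p * q) * q⁻¹)),
    TensorProduct.map LinearMap.id (LinearMap.mul' k (H q))
      (TensorProduct.map LinearMap.id
        (TensorProduct.map LinearMap.id ((lcast k (inv_inv q)).comp (S q⁻¹)))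
        ((TensorProduct.assoc k (H p) (H q) (H q⁻¹))
          (TensorProduct.map (Δ p q).toLinearMap LinearMap.id
            (Δ (p * q) q⁻¹ h))))
      = lcast k (mul_inv_cancel_right p q) h ⊗ₜ[k] (1 : H q)
  /-- `h_(11,p) ⊗ S_{q⁻¹}(h_(12,q⁻¹))h_(2,q) = h ⊗ 1_q` -/
  antipode_4 : ∀ (p q : G) (h : H ((p * q⁻¹) * q)),
    TensorProduct.map LinearMap.id (LinearMap.mul' k (H q))
      (TensorProduct.map LinearMap.id
        (TensorProduct.map ((lcast k (inv_inv q)).comp (S q⁻¹)) LinearMap.id)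
        ((TensorProduct.assoc k (H p) (H q⁻¹) (H q))
          (TensorProduct.map (Δ p q⁻¹).toLinearMap LinearMap.id
            (Δ (p * q⁻¹) q h))))
      = lcast k (inv_mul_cancel_right p q) h ⊗ₜ[k] (1 : H q)

/-- A realization of the Ore extension `A[y; τ, δ]` : a `k`-algebra `R` containing `A`
(via `ι`), free as a left `A`-module with basis `{yⁿ}`, with `y·a = τ(a)y + δ(a)`. -/
structure OreData (A R : Type*) [Ring A] [Algebra k A] [Ring R] [Algebra k R]
    (τ : A →ₐ[k] A) (δ : A →ₗ[k] A) where
  ι : A →ₐ[k] R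
  y : R
  rel : ∀ a : A, y * ι a = ι (τ a) * y + ι (δ a)
  free : ∀ f : ℕ →₀ A, (f.sum fun n a => ι a * y ^ n) = 0 → f = 0
  span : ∀ x : R, ∃ f : ℕ →₀ A, x = f.sum fun n a => ι a * y ^ n

/-- A group-cograded Hopf coquasigroup-Ore extension of `H` : the family
`R_p = H_p[y_p; τ_p, δ_p]` carrying a `G`-cograded Hopf coquasigroup structure
whose structure maps restrict on the subalgebras `H_p` to those of `H`. -/
structure GCHCQGOreExt {H : G → Type*} [∀ p, Ring (H p)] [∀ p, Algebra k (H p)]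
    (HH : GCHCQG k H)
    (R : G → Type*) [∀ p, Ring (R p)] [∀ p, Algebra k (R p)]
    (τ : ∀ p : G, H p →ₐ[k] H p) (δ : ∀ p : G, H p →ₗ[k] H p) where
  RR : GCHCQG k R
  ore : ∀ p : G, OreData k (H p) (R p) (τ p) (δ p)
  deriv : ∀ (p : G) (a b : H p), δ p (a * b) = δ p a * b + τ p a * δ p b
  compat_Δ : ∀ (p q : G) (h : H (p * q)),
    RR.Δ p q ((ore (p * q)).ι h)
      = TensorProduct.map ((ore p).ι).toLinearMap ((ore q).ι).toLinearMap (HH.Δ p q h)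
  compat_ε : ∀ h : H (1 : G), RR.ε ((ore 1).ι h) = HH.ε h
  compat_S : ∀ (p : G) (h : H p), RR.S p ((ore p).ι h) = (ore p⁻¹).ι (HH.S p h)

/-- A Hopf coquasigroup over the field `k`. -/
structure HopfCoquasigroup (H : Type*) [Ring H] [Algebra k H] where
  Δ : H →ₐ[k] H ⊗[k] H
  ε : H →ₐ[k] k
  S : H →ₗ[k] H
  counit_left : ∀ h : H,
    TensorProduct.lid k H (TensorProduct.map ε.toLinearMap LinearMap.id (Δ h)) = h
  counit_right : ∀ h : H,
    TensorProduct.rid k H (TensorProduct.map LinearMap.id ε.toLinearMap (Δ h)) = h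
  antipode_1 : ∀ h : H,
    TensorProduct.map (LinearMap.mul' k H) LinearMap.id
      (TensorProduct.map (TensorProduct.map S LinearMap.id) LinearMap.id
        ((TensorProduct.assoc k H H H).symm
          (TensorProduct.map LinearMap.id Δ.toLinearMap (Δ h))))
      = (1 : H) ⊗ₜ[k] h
  antipode_2 : ∀ h : H,
    TensorProduct.map (LinearMap.mul' k H) LinearMap.id
      (TensorProduct.map (TensorProduct.map LinearMap.id S) LinearMap.id
        ((TensorProduct.assoc k H H H).symm
          (TensorProduct.map LinearMap.id Δ.toLinearMap (Δ h))))
      = (1 : H) ⊗ₜ[k] h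
  antipode_3 : ∀ h : H,
    TensorProduct.map LinearMap.id (LinearMap.mul' k H)
      (TensorProduct.map LinearMap.id (TensorProduct.map S LinearMap.id)
        ((TensorProduct.assoc k H H H)
          (TensorProduct.map Δ.toLinearMap LinearMap.id (Δ h))))
      = h ⊗ₜ[k] (1 : H)
  antipode_4 : ∀ h : H,
    TensorProduct.map LinearMap.id (LinearMap.mul' k H)
      (TensorProduct.map LinearMap.id (TensorProduct.map LinearMap.id S)
        ((TensorProduct.assoc k H H H)
          (TensorProduct.map Δ.toLinearMap LinearMap.id (Δ h))))
      = h ⊗ₜ[k] (1 : H)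

end Preliminaries

theorem lcast_family (k : Type*) [Field k] {G : Type*} {H : G → Type*}
    [∀ p, AddCommMonoid (H p)] [∀ p, Module k (H p)] (x : ∀ p, H p) {p q : G} (e : p = q) :
    lcast k e (x p) = x q := by
  subst e; rfl

theorem lcast_map (k : Type*) [Field k] {G : Type*} {H R : G → Type*}
    [∀ p, AddCommMonoid (H p)] [∀ p, Module k (H p)]
    [∀ p, AddCommMonoid (R p)] [∀ p, Module k (R p)]
    (f : ∀ p, H p → R p) {p q : G} (e : p = q) (x : H p) :
    lcast k e (f p x) = f q (lcast k e x) := by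
  subst e; rfl

namespace OreData

variable {k A R : Type*} [Field k] [Ring A] [Algebra k A] [Ring R] [Algebra k R]
  {τ : A →ₐ[k] A} {δ : A →ₗ[k] A}

theorem one_notMem_span_y [Nontrivial R] (D : OreData k A R τ δ) :
    (1 : R) ∉ Submodule.span k {D.y} := by
  intro h
  obtain ⟨c, hc⟩ := Submodule.mem_span_singleton.mp h
  have hzero := D.free (Finsupp.single 0 1 + Finsupp.single 1 (algebraMap k A (-c))) (by
    rw [Finsupp.sum_add_index' (by simp) (by simp [add_mul]), Finsupp.sum_single_index (by simp),
      Finsupp.sum_single_index (by simp), D.ι.commutes, ← Algebra.smul_def, pow_one, neg_smul, hc]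
    simp)
  have hone : (1 : A) = 0 := by simpa using DFunLike.congr_fun hzero 0
  exact one_ne_zero (α := R) (by simpa using congrArg D.ι hone)

/-- The coefficients of `1` and `y` in the Ore extension can be separated by a linear form. -/
theorem exists_dual_y_eq_zero [Nontrivial R] (D : OreData k A R τ δ) :
    ∃ f : R →ₗ[k] k, f 1 ≠ 0 ∧ f D.y = 0 := by
  obtain ⟨f, hf, hle⟩ := Submodule.exists_le_ker_of_notMem D.one_notMem_span_y
  exact ⟨f, hf, hle (Submodule.mem_span_singleton_self _)⟩

end OreData

/-- Lemma 4.2: If `R = (H_p[y_p; τ_p, δ_p])` is a group-cograded Hopf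
coquasigroup-Ore extension of `H` with `Δ_{p,q}(y_{pq}) = y_p ⊗ 1_q + r_p ⊗ y_q`,
then `S_{p⁻¹}(y_{p⁻¹}) = −S_{p⁻¹}(r_{p⁻¹})·y_p` for every `p ∈ G`. -/
theorem statement2 (k : Type*) [Field k] {G : Type*} [Group G]
    (H : G → Type*) [∀ p, Ring (H p)] [∀ p, Algebra k (H p)]
    (HH : GCHCQG k H)
    (R : G → Type*) [∀ p, Ring (R p)] [∀ p, Algebra k (R p)]
    (τ : ∀ p : G, H p →ₐ[k] H p) (δ : ∀ p : G, H p →ₗ[k] H p)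
    (ext : GCHCQGOreExt k HH R τ δ)
    (r : ∀ p : G, H p)
    (hy : ∀ p q : G,
      ext.RR.Δ p q ((ext.ore (p * q)).y)
        = (ext.ore p).y ⊗ₜ[k] (1 : R q) + (ext.ore p).ι (r p) ⊗ₜ[k] (ext.ore q).y) :
    ∀ p : G,
      lcast k (inv_inv p) (ext.RR.S p⁻¹ ((ext.ore p⁻¹).y))
        = - ((ext.ore p).ι (lcast k (inv_inv p) (HH.S p⁻¹ (r p⁻¹))) * (ext.ore p).y) := by
  intro q
  rcases subsingleton_or_nontrivial (R q) with _ | _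
  · exact Subsingleton.elim _ _
  obtain ⟨f, hf, hfy⟩ := (ext.ore q).exists_dual_y_eq_zero
  have key := ext.RR.antipode_1 q q (ext.ore (q⁻¹ * (q * q))).y
  rw [hy, lcast_family k (fun p => (ext.ore p).y)] at key
  simp only [map_add, TensorProduct.map_tmul, AlgHom.toLinearMap_apply, map_one, hy,
    Algebra.TensorProduct.one_def, TensorProduct.tmul_add, TensorProduct.assoc_symm_tmul,
    LinearMap.id_apply, LinearMap.comp_apply, LinearMap.mul'_apply, mul_one,
    ext.compat_S, lcast_map k (fun p => (ext.ore p).ι)] at key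
  have hsum := congrArg
    (fun t => TensorProduct.rid k (R q) (TensorProduct.map LinearMap.id f t)) key
  simp only [map_add, TensorProduct.map_tmul, TensorProduct.rid_tmul, LinearMap.id_apply, hfy,
    zero_smul, add_zero, ← smul_add] at hsum
  exact eq_neg_of_add_eq_zero_left ((smul_eq_zero_iff_right hf).mp hsum)
end

section
/- Let H = (H_p)_{p in G} be a G-cograded Hopf coquasigroup equipped with: a k-algebra homomorphism χ : H_1 → k; a family of elements r_p in H_p with Δ_{p,q}(r_{pq}) = r_p ⊗ r_q for all p,q and ε(r_1) = 1 (so each r_p is invertible with r_p⁻¹ = S_{p⁻¹}(r_{p⁻¹})); algebra endomorphisms τ_p of H_p given by τ_p(h) = χ(h_(1,1))h_(2,p); and τ_p-derivations δ_p of H_p with ε(δ_1(h)) = 0 for all h in H_1. Assume that for all p,q in G and h in H_{pq}: χ(h_(1,1))h_(21,p) ⊗ h_(22,q) = r_p h_(1,p) r_p⁻¹ χ(h_(21,1)) ⊗ h_(22,q) = χ(h_(11,1))h_(12,p) ⊗ h_(2,q), and Δ_{p,q}(δ_{pq}(h)) = δ_p(h_(1,p)) ⊗ h_(2,q) + r_p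 h_(1,p) ⊗ δ_q(h_(2,q)). Assume moreover that the antipode of H is anti-comultiplicative: Δ_{p,q}(S_{(pq)⁻¹}(h)) = S_{p⁻¹}(h_(2,p⁻¹)) ⊗ S_{q⁻¹}(h_(1,q⁻¹)) for all h in H_{(pq)⁻¹}, where Δ_{q⁻¹,p⁻¹}(h) = h_(1,q⁻¹) ⊗ h_(2,p⁻¹). Then the family R = (H_p[y_p; τ_p, δ_p])_{p in G} of Ore extensions admits a G-cograded Hopf coquasigroup structure whose structure maps restrict on each H_p to those of H and which satisfies Δ_{p,q}(y_{pq}) = y_p ⊗ 1_q + r_p ⊗ y_q, ε(y_1) = 0, and S_{p⁻¹}(y_{p⁻¹}) = −r_p⁻¹·y_p. -/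
open scoped TensorProduct

section Lcast

variable {k : Type*} [Field k] {G : Type*} {H : G → Type*}

theorem lcast_rfl [∀ p, AddCommMonoid (H p)] [∀ p, Module k (H p)] {p : G} (e : p = p) :
    lcast k e = (LinearMap.id : H p →ₗ[k] H p) := rfl

theorem lcast_lcast [∀ p, AddCommMonoid (H p)] [∀ p, Module k (H p)] {p q s : G}
    (e : p = q) (e' : q = s) (h : H p) : lcast k e' (lcast k e h) = lcast k (e.trans e') h := by
  subst e e'; rfl

/-- `lcast` commutes with every family of maps. -/
theorem map_lcast [∀ p, AddCommMonoid (H p)] [∀ p, Module k (H p)] {H' : G → Type*}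
    [∀ p, AddCommMonoid (H' p)] [∀ p, Module k (H' p)] (f : ∀ p, H p → H' p) {p q : G}
    (e : p = q) (h : H p) : f q (lcast k e h) = lcast k e (f p h) := by
  subst e; rfl

theorem lcast_section [∀ p, AddCommMonoid (H p)] [∀ p, Module k (H p)] (f : ∀ p, H p) {p q : G}
    (e : p = q) : lcast k e (f p) = f q := by
  subst e; rfl

/-- `lcast` as a homomorphism of algebras. -/
def lcastAlgHom [∀ p, Ring (H p)] [∀ p, Algebra k (H p)] {p q : G} (e : p = q) :
    H p →ₐ[k] H q :=
  AlgHom.ofLinearMap (lcast k e) (by subst e; rfl) (by subst e; intros; rfl)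

end Lcast

section Convolution

variable {k : Type*} [Field k] {A B C A' B' C' : Type*}
  [Ring A] [Algebra k A] [Ring B] [Algebra k B] [Ring C] [Algebra k C]
  [Ring A'] [Algebra k A'] [Ring B'] [Algebra k B'] [Ring C'] [Algebra k C']

/-- The map `a ⊗ b ⊗ c ↦ s(a) b ⊗ c`. -/
def antipodeMap₁ (s : A →ₗ[k] B) : A ⊗[k] (B ⊗[k] C) →ₗ[k] B ⊗[k] C :=
  TensorProduct.map (LinearMap.mul' k B) LinearMap.id ∘ₗ
    TensorProduct.map (TensorProduct.map s LinearMap.id) LinearMap.id ∘ₗ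
      (TensorProduct.assoc k A B C).symm.toLinearMap

/-- The map `a ⊗ b ⊗ c ↦ a s(b) ⊗ c`. -/
def antipodeMap₂ (s : B →ₗ[k] A) : A ⊗[k] (B ⊗[k] C) →ₗ[k] A ⊗[k] C :=
  TensorProduct.map (LinearMap.mul' k A) LinearMap.id ∘ₗ
    TensorProduct.map (TensorProduct.map LinearMap.id s) LinearMap.id ∘ₗ
      (TensorProduct.assoc k A B C).symm.toLinearMap

/-- The map `a ⊗ b ⊗ c ↦ a ⊗ b s(c)`. -/
def antipodeMap₃ (s : C →ₗ[k] B) : (A ⊗[k] B) ⊗[k] C →ₗ[k] A ⊗[k] B :=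
  TensorProduct.map LinearMap.id (LinearMap.mul' k B) ∘ₗ
    TensorProduct.map LinearMap.id (TensorProduct.map LinearMap.id s) ∘ₗ
      (TensorProduct.assoc k A B C).toLinearMap

/-- The map `a ⊗ b ⊗ c ↦ a ⊗ s(b) c`. -/
def antipodeMap₄ (s : B →ₗ[k] C) : (A ⊗[k] B) ⊗[k] C →ₗ[k] A ⊗[k] C :=
  TensorProduct.map LinearMap.id (LinearMap.mul' k C) ∘ₗ
    TensorProduct.map LinearMap.id (TensorProduct.map s LinearMap.id) ∘ₗ
      (TensorProduct.assoc k A B C).toLinearMap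

@[simp] theorem antipodeMap₁_tmul (s : A →ₗ[k] B) (a : A) (b : B) (c : C) :
    antipodeMap₁ s (a ⊗ₜ (b ⊗ₜ c)) = (s a * b) ⊗ₜ[k] c := rfl

@[simp] theorem antipodeMap₂_tmul (s : B →ₗ[k] A) (a : A) (b : B) (c : C) :
    antipodeMap₂ s (a ⊗ₜ (b ⊗ₜ c)) = (a * s b) ⊗ₜ[k] c := rfl

@[simp] theorem antipodeMap₃_tmul (s : C →ₗ[k] B) (a : A) (b : B) (c : C) :
    antipodeMap₃ s ((a ⊗ₜ b) ⊗ₜ c) = a ⊗ₜ[k] (b * s c) := rfl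

@[simp] theorem antipodeMap₄_tmul (s : B →ₗ[k] C) (a : A) (b : B) (c : C) :
    antipodeMap₄ s ((a ⊗ₜ b) ⊗ₜ c) = a ⊗ₜ[k] (s b * c) := rfl

theorem antipodeMap₁_tmul_eq (s : A →ₗ[k] B) (a : A) (u : B ⊗[k] C) :
    antipodeMap₁ s (a ⊗ₜ u) = (s a ⊗ₜ 1) * u := by
  induction u with
  | zero => simp
  | tmul b c => simp
  | add x y hx hy => rw [TensorProduct.tmul_add, map_add, hx, hy, mul_add]

theorem antipodeMap₁_mul (s : A →ₗ[k] B) (hs : ∀ a b, s (a * b) = s b * s a)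
    {t : A ⊗[k] (B ⊗[k] C)} {z : C} (ht : antipodeMap₁ s t = 1 ⊗ₜ z)
    (t' : A ⊗[k] (B ⊗[k] C)) :
    antipodeMap₁ s (t * t') = (1 ⊗ₜ z) * antipodeMap₁ s t' := by
  induction t' with
  | zero => simp
  | add x y hx hy => rw [mul_add, map_add, hx, hy, map_add, mul_add]
  | tmul a u =>
    have key : antipodeMap₁ s (t * a ⊗ₜ u) = (s a ⊗ₜ 1) * antipodeMap₁ s t * u := by
      clear ht
      induction t with
      | zero => simp
      | add x y hx hy => rw [add_mul, map_add, hx, hy, map_add, mul_add, add_mul]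
      | tmul a' u' =>
        rw [Algebra.TensorProduct.tmul_mul_tmul, antipodeMap₁_tmul_eq, antipodeMap₁_tmul_eq, hs]
        simp only [← mul_assoc, Algebra.TensorProduct.tmul_mul_tmul, mul_one]
    rw [key, ht, antipodeMap₁_tmul_eq, ← mul_assoc]
    simp

theorem antipodeMap₂_mul (s : B →ₗ[k] A) (hs : ∀ a b, s (a * b) = s b * s a)
    (t : A ⊗[k] (B ⊗[k] C)) {t' : A ⊗[k] (B ⊗[k] C)} {z : C}
    (ht : antipodeMap₂ s t' = 1 ⊗ₜ z) :
    antipodeMap₂ s (t * t') = antipodeMap₂ s t * (1 ⊗ₜ z) := by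
  induction t with
  | zero => simp
  | add x y hx hy => rw [add_mul, map_add, hx, hy, map_add, add_mul]
  | tmul a u =>
  induction u with
  | zero => simp
  | add x y hx hy => rw [TensorProduct.tmul_add, add_mul, map_add, hx, hy, map_add, add_mul]
  | tmul b c =>
    have key : antipodeMap₂ s (a ⊗ₜ (b ⊗ₜ c) * t')
        = (a ⊗ₜ c) * antipodeMap₂ s t' * (s b ⊗ₜ 1) := by
      clear ht
      induction t' with
      | zero => simp
      | add x y hx hy => rw [mul_add, map_add, hx, hy, map_add, mul_add, add_mul]
      | tmul a' u' =>
      induction u' with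
      | zero => simp
      | add x y hx hy =>
        rw [TensorProduct.tmul_add, mul_add, map_add, hx, hy, map_add, mul_add, add_mul]
      | tmul b' c' => simp [hs, mul_assoc]
    rw [key, ht]
    simp

theorem antipodeMap₃_mul (s : C →ₗ[k] B) (hs : ∀ a b, s (a * b) = s b * s a)
    (t : (A ⊗[k] B) ⊗[k] C) {t' : (A ⊗[k] B) ⊗[k] C} {z : A}
    (ht : antipodeMap₃ s t' = z ⊗ₜ 1) :
    antipodeMap₃ s (t * t') = antipodeMap₃ s t * (z ⊗ₜ 1) := by
  induction t with
  | zero => simp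
  | add x y hx hy => rw [add_mul, map_add, hx, hy, map_add, add_mul]
  | tmul u c =>
  induction u with
  | zero => simp
  | add x y hx hy => rw [TensorProduct.add_tmul, add_mul, map_add, hx, hy, map_add, add_mul]
  | tmul a b =>
    have key : antipodeMap₃ s ((a ⊗ₜ b) ⊗ₜ c * t')
        = (a ⊗ₜ b) * antipodeMap₃ s t' * (1 ⊗ₜ s c) := by
      clear ht
      induction t' with
      | zero => simp
      | add x y hx hy => rw [mul_add, map_add, hx, hy, map_add, mul_add, add_mul]
      | tmul u' c' =>
      induction u' with
      | zero => simp
      | add x y hx hy =>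
        rw [TensorProduct.add_tmul, mul_add, map_add, hx, hy, map_add, mul_add, add_mul]
      | tmul a' b' => simp [hs, mul_assoc]
    rw [key, ht]
    simp

theorem antipodeMap₄_mul (s : B →ₗ[k] C) (hs : ∀ a b, s (a * b) = s b * s a)
    {t : (A ⊗[k] B) ⊗[k] C} {z : A} (ht : antipodeMap₄ s t = z ⊗ₜ 1)
    (t' : (A ⊗[k] B) ⊗[k] C) :
    antipodeMap₄ s (t * t') = (z ⊗ₜ 1) * antipodeMap₄ s t' := by
  induction t' with
  | zero => simp
  | add x y hx hy => rw [mul_add, map_add, hx, hy, map_add, mul_add]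
  | tmul u' c' =>
  induction u' with
  | zero => simp
  | add x y hx hy => rw [TensorProduct.add_tmul, mul_add, map_add, hx, hy, map_add, mul_add]
  | tmul a' b' =>
    have key : antipodeMap₄ s (t * (a' ⊗ₜ b') ⊗ₜ c')
        = (1 ⊗ₜ s b') * antipodeMap₄ s t * (a' ⊗ₜ c') := by
      clear ht
      induction t with
      | zero => simp
      | add x y hx hy => rw [add_mul, map_add, hx, hy, map_add, mul_add, add_mul]
      | tmul u c =>
      induction u with
      | zero => simp
      | add x y hx hy =>
        rw [TensorProduct.add_tmul, add_mul, map_add, hx, hy, map_add, mul_add, add_mul]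
      | tmul a b => simp [hs, mul_assoc]
    rw [key, ht]
    simp

theorem antipodeMap₁_map (f : A →ₗ[k] A') (g : B →ₐ[k] B') (h : C →ₗ[k] C')
    (s : A →ₗ[k] B) (s' : A' →ₗ[k] B') (hs : ∀ a, s' (f a) = g (s a)) (t : A ⊗[k] (B ⊗[k] C)) :
    antipodeMap₁ s' (TensorProduct.map f (TensorProduct.map g.toLinearMap h) t)
      = TensorProduct.map g.toLinearMap h (antipodeMap₁ s t) := by
  rw [← LinearMap.comp_apply, ← LinearMap.comp_apply]
  congr 1
  ext a b c
  simp [hs]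

theorem antipodeMap₂_map (f : A →ₐ[k] A') (g : B →ₗ[k] B') (h : C →ₗ[k] C')
    (s : B →ₗ[k] A) (s' : B' →ₗ[k] A') (hs : ∀ b, s' (g b) = f (s b)) (t : A ⊗[k] (B ⊗[k] C)) :
    antipodeMap₂ s' (TensorProduct.map f.toLinearMap (TensorProduct.map g h) t)
      = TensorProduct.map f.toLinearMap h (antipodeMap₂ s t) := by
  rw [← LinearMap.comp_apply, ← LinearMap.comp_apply]
  congr 1
  ext a b c
  simp [hs]

theorem antipodeMap₃_map (f : A →ₗ[k] A') (g : B →ₐ[k] B') (h : C →ₗ[k] C')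
    (s : C →ₗ[k] B) (s' : C' →ₗ[k] B') (hs : ∀ c, s' (h c) = g (s c)) (t : (A ⊗[k] B) ⊗[k] C) :
    antipodeMap₃ s' (TensorProduct.map (TensorProduct.map f g.toLinearMap) h t)
      = TensorProduct.map f g.toLinearMap (antipodeMap₃ s t) := by
  rw [← LinearMap.comp_apply, ← LinearMap.comp_apply]
  congr 1
  ext a b c
  simp [hs]

theorem antipodeMap₄_map (f : A →ₗ[k] A') (g : B →ₗ[k] B') (h : C →ₐ[k] C')
    (s : B →ₗ[k] C) (s' : B' →ₗ[k] C') (hs : ∀ b, s' (g b) = h (s b)) (t : (A ⊗[k] B) ⊗[k] C) :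
    antipodeMap₄ s' (TensorProduct.map (TensorProduct.map f g) h.toLinearMap t)
      = TensorProduct.map f h.toLinearMap (antipodeMap₄ s t) := by
  rw [← LinearMap.comp_apply, ← LinearMap.comp_apply]
  congr 1
  ext a b c
  simp [hs]

end Convolution

namespace OreData

variable {k : Type*} [Field k] {A R : Type*} [Ring A] [Algebra k A] [Ring R] [Algebra k R]
  {τ : A →ₐ[k] A} {δ : A →ₗ[k] A}

theorem induction (O : OreData k A R τ δ) {P : R → Prop} (hι : ∀ a, P (O.ι a)) (hy : P O.y)
    (hadd : ∀ x z, P x → P z → P (x + z)) (hmul : ∀ x z, P x → P z → P (x * z)) (x : R) :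
    P x := by
  obtain ⟨f, rfl⟩ := O.span x
  have h1 : P 1 := by simpa using hι 1
  have h0 : P 0 := by simpa using hι 0
  have hpow : ∀ n : ℕ, P (O.y ^ n) := fun n => by
    induction n with
    | zero => simpa using h1
    | succ n ih => rw [pow_succ]; exact hmul _ _ ih hy
  exact Finset.sum_induction _ P hadd h0 fun n _ => hmul _ _ (hι _) (hpow n)

/-- The linear map `∑ aₙ yⁿ ↦ ∑ f(aₙ) Yⁿ` on coefficient sequences. -/
noncomputable def evalCoeffs {B : Type*} [Ring B] [Algebra k B] (f : A →ₐ[k] B) (Y : B) :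
    (ℕ →₀ A) →ₗ[k] B :=
  Finsupp.lsum k fun n => (LinearMap.mulRight k (Y ^ n)).comp f.toLinearMap

theorem evalCoeffs_apply {B : Type*} [Ring B] [Algebra k B] (f : A →ₐ[k] B) (Y : B)
    (c : ℕ →₀ A) : evalCoeffs f Y c = c.sum fun n a => f a * Y ^ n := rfl

theorem evalCoeffs_single {B : Type*} [Ring B] [Algebra k B] (f : A →ₐ[k] B) (Y : B)
    (n : ℕ) (a : A) : evalCoeffs f Y (Finsupp.single n a) = f a * Y ^ n := by
  rw [evalCoeffs_apply, Finsupp.sum_single_index (by simp)]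

theorem evalCoeffs_bijective (O : OreData k A R τ δ) :
    Function.Bijective (evalCoeffs O.ι O.y) := by
  refine ⟨(injective_iff_map_eq_zero _).2 fun c hc => O.free c hc, fun x => ?_⟩
  obtain ⟨c, hc⟩ := O.span x
  exact ⟨c, hc.symm⟩

/-- The universal property of Ore extensions. -/
theorem exists_lift (O : OreData k A R τ δ) {B : Type*} [Ring B] [Algebra k B] (f : A →ₐ[k] B)
    (Y : B) (hY : ∀ a, Y * f a = f (τ a) * Y + f (δ a)) :
    ∃ F : R →ₐ[k] B, (∀ a, F (O.ι a) = f a) ∧ F O.y = Y := by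
  let e := LinearEquiv.ofBijective _ O.evalCoeffs_bijective
  let F : R →ₗ[k] B := evalCoeffs f Y ∘ₗ e.symm.toLinearMap
  have hmon : ∀ a n, F (O.ι a * O.y ^ n) = f a * Y ^ n := fun a n => by
    have : O.ι a * O.y ^ n = e (Finsupp.single n a) := (evalCoeffs_single _ _ _ _).symm
    simp only [F, this, LinearMap.comp_apply, LinearEquiv.coe_coe, e.symm_apply_apply,
      evalCoeffs_single]
  have hFι : ∀ a, F (O.ι a) = f a := fun a => by simpa using hmon a 0
  have hFy : F O.y = Y := by simpa using hmon 1 1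
  have hspan : ∀ {P : R → Prop}, (∀ a n, P (O.ι a * O.y ^ n)) →
      (∀ x z, P x → P z → P (x + z)) → ∀ x, P x := by
    intro P h hadd x
    obtain ⟨c, rfl⟩ := O.span x
    exact Finset.sum_induction _ P hadd (by simpa using h 0 0) fun n _ => h _ _
  have hmul : ∀ x z, F (x * z) = F x * F z := by
    intro x
    induction x using O.induction with
    | hι b =>
      refine hspan (fun a n => ?_) fun x z hx hz => by rw [mul_add, map_add, hx, hz, map_add,
        mul_add]
      rw [← mul_assoc, ← map_mul, hmon, hmon, hFι, map_mul, mul_assoc]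
    | hy =>
      refine hspan (fun a n => ?_) fun x z hx hz => by rw [mul_add, map_add, hx, hz, map_add,
        mul_add]
      rw [← mul_assoc, O.rel, add_mul, mul_assoc, ← pow_succ', map_add, hmon, hmon, hmon, hFy,
        ← mul_assoc, hY, add_mul, mul_assoc, ← pow_succ']
    | hadd x x' hx hx' => intro z; rw [add_mul, map_add, hx, hx', map_add, add_mul]
    | hmul x x' hx hx' => intro z; rw [mul_assoc, hx, hx', hx, mul_assoc]
  exact ⟨AlgHom.ofLinearMap F (by simpa using hFι 1) hmul, hFι, hFy⟩

end OreData

namespace GCHCQG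

variable {k : Type*} [Field k] {G : Type*} [Group G] {H : G → Type*}
  [∀ p, Ring (H p)] [∀ p, Algebra k (H p)] (W : GCHCQG k H)

/-- The antipode `S_{q⁻¹}`, viewed with values in `H_q`. -/
def invS (q : G) : H q⁻¹ →ₗ[k] H q := (lcast k (inv_inv q)).comp (W.S q⁻¹)

theorem invS_one (q : G) : W.invS q 1 = 1 := by
  rw [invS, LinearMap.comp_apply, S_one]
  exact lcast_section (fun p => (1 : H p)) _

theorem invS_mul (q : G) (a b : H q⁻¹) : W.invS q (a * b) = W.invS q b * W.invS q a := by
  rw [invS, LinearMap.comp_apply, S_mul]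
  exact map_mul (lcastAlgHom (k := k) (inv_inv q)) _ _

theorem invS_lcast {p q : G} (e : p = q) (h : H p⁻¹) :
    W.invS q (lcast k (congrArg _ e) h) = lcast k e (W.invS p h) := by
  subst e; rfl

theorem S_eq_invS (p : G) (h : H p) :
    W.S p h = W.invS p⁻¹ (lcast k (inv_inv p).symm h) := by
  have key : ∀ {p q : G} (e : p = q) (h : H p),
      W.S q (lcast k e h) = lcast k (congrArg _ e) (W.S p h) := by
    intro p q e h
    subst e
    rfl
  rw [invS, LinearMap.comp_apply, key, lcast_lcast, lcast_rfl, LinearMap.id_apply]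

theorem Δ_lcast {p p' q q' : G} (e₁ : p = p') (e₂ : q = q') (e : p * q = p' * q')
    (h : H (p * q)) :
    W.Δ p' q' (lcast k e h) = TensorProduct.map (lcast k e₁) (lcast k e₂) (W.Δ p q h) := by
  subst e₁ e₂
  simp [lcast_rfl]

theorem counit_right_of_eq_one {p u : G} (e : u = 1) (h : H (p * u)) :
    TensorProduct.rid k (H p)
      (TensorProduct.map LinearMap.id (W.ε.toLinearMap ∘ₗ lcast k e) (W.Δ p u h))
      = lcast k (by rw [e, mul_one]) h := by
  subst e
  exact W.counit_right p h

theorem mul_antipode (q : G) (h : H (q * q⁻¹)) :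
    LinearMap.mul' k (H q) (TensorProduct.map LinearMap.id (W.invS q) (W.Δ q q⁻¹ h))
      = algebraMap k (H q) (W.ε (lcast k (mul_inv_cancel q) h)) := by
  have h2 := congrArg (fun t => TensorProduct.rid k (H q)
    (TensorProduct.map LinearMap.id W.ε.toLinearMap t))
    (W.antipode_2 1 q (lcast k (by simp) h))
  change TensorProduct.rid k (H q) (TensorProduct.map LinearMap.id W.ε.toLinearMap
    (antipodeMap₂ (W.invS q) (TensorProduct.map LinearMap.id (W.Δ q⁻¹ 1).toLinearMap _))) = _ at h2
  have key : ∀ t : H q ⊗[k] H (q⁻¹ * 1),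
      TensorProduct.rid k (H q) (TensorProduct.map LinearMap.id W.ε.toLinearMap
        (antipodeMap₂ (W.invS q) (TensorProduct.map LinearMap.id (W.Δ q⁻¹ 1).toLinearMap t)))
      = LinearMap.mul' k (H q)
        (TensorProduct.map LinearMap.id (W.invS q ∘ₗ lcast k (mul_one q⁻¹)) t) := by
    intro t
    induction t with
    | zero => simp
    | add x y hx hy => simp only [map_add, hx, hy]
    | tmul a b =>
      simp only [TensorProduct.map_tmul, LinearMap.id_apply, LinearMap.mul'_apply,
        LinearMap.comp_apply, ← W.counit_right, AlgHom.toLinearMap_apply]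
      generalize W.Δ q⁻¹ 1 b = u
      induction u with
      | zero => simp
      | add x y hx hy => simp only [TensorProduct.tmul_add, map_add, hx, hy, mul_add]
      | tmul c d => simp
  rw [key, W.Δ_lcast rfl (mul_one q⁻¹).symm] at h2
  rw [lcast_lcast] at h2
  rw [TensorProduct.map_tmul, TensorProduct.rid_tmul, LinearMap.id_apply,
    ← Algebra.algebraMap_eq_smul_one] at h2
  refine Eq.trans ?_ h2
  rw [← LinearMap.comp_apply (TensorProduct.map _ _), ← TensorProduct.map_comp]
  congr 3
  ext x
  simp [lcast_lcast, lcast_rfl]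

/-- A linear map whose convolution with the identity vanishes is zero. -/
theorem eq_zero_of_convolution (q : G) (F : H q⁻¹ →ₗ[k] H q)
    (hF : ∀ x : H (q * q⁻¹), LinearMap.mul' k (H q)
      (TensorProduct.map LinearMap.id F (W.Δ q q⁻¹ x)) = 0) (h : H q⁻¹) : F h = 0 := by
  have h1 : antipodeMap₁ (W.invS q) (TensorProduct.map LinearMap.id (W.Δ q q⁻¹).toLinearMap
      (W.Δ q⁻¹ (q * q⁻¹) _)) = _ :=
    W.antipode_1 q⁻¹ q (lcast k (inv_mul_cancel_left q q⁻¹).symm h)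
  rw [lcast_lcast, lcast_rfl, LinearMap.id_apply] at h1
  have h2 := congrArg (fun t => LinearMap.mul' k (H q) (TensorProduct.map LinearMap.id F t)) h1
  simp only [TensorProduct.map_tmul, LinearMap.mul'_apply, LinearMap.id_apply, one_mul] at h2
  rw [← h2]
  generalize W.Δ q⁻¹ (q * q⁻¹) _ = t
  induction t with
  | zero => simp
  | add x y hx hy => rw [map_add, map_add, map_add, map_add, hx, hy, add_zero]
  | tmul a b =>
    have key : ∀ u : H q ⊗[k] H q⁻¹, LinearMap.mul' k (H q) (TensorProduct.map LinearMap.id F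
        (antipodeMap₁ (W.invS q) (a ⊗ₜ u)))
        = W.invS q a * LinearMap.mul' k (H q) (TensorProduct.map LinearMap.id F u) := by
      intro u
      induction u with
      | zero => simp
      | add x y hx hy => simp only [TensorProduct.tmul_add, map_add, hx, hy, mul_add]
      | tmul c d => simp [mul_assoc]
    rw [TensorProduct.map_tmul, AlgHom.toLinearMap_apply, LinearMap.id_apply, key, hF, mul_zero]

end GCHCQG

namespace GCHCQG

variable {k : Type*} [Field k] {G : Type*} [Group G] {H : G → Type*}
  [∀ p, Ring (H p)] [∀ p, Algebra k (H p)]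

/-- The data from which the comultiplication, counit and antipode of `W` extend to the Ore
extensions `H_p[y_p; τ_p, δ_p]`. -/
structure IsOreDatum (W : GCHCQG k H) (χ : H (1 : G) →ₐ[k] k) (r : ∀ p : G, H p)
    (τ : ∀ p : G, H p →ₐ[k] H p) (δ : ∀ p : G, H p →ₗ[k] H p) : Prop where
  Δ_r : ∀ p q : G, W.Δ p q (r (p * q)) = r p ⊗ₜ[k] r q
  ε_r : W.ε (r 1) = 1
  τ_eq : ∀ (p : G) (h : H p), τ p h = TensorProduct.lid k (H p)
    (TensorProduct.map χ.toLinearMap LinearMap.id (W.Δ 1 p (lcast k (one_mul p).symm h)))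
  Δ_τ_left : ∀ (p q : G) (h : H (p * q)), W.Δ p q (τ (p * q) h)
    = TensorProduct.map (τ p).toLinearMap LinearMap.id (W.Δ p q h)
  Δ_τ_right : ∀ (p q : G) (h : H (p * q)), W.Δ p q (τ (p * q) h)
    = TensorProduct.map ((LinearMap.mulLeft k (r p)).comp
        (LinearMap.mulRight k (W.invS p (r p⁻¹)))) (τ q).toLinearMap (W.Δ p q h)
  δ_mul : ∀ (p : G) (a b : H p), δ p (a * b) = δ p a * b + τ p a * δ p b
  ε_δ : ∀ h : H (1 : G), W.ε (δ 1 h) = 0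
  Δ_δ : ∀ (p q : G) (h : H (p * q)), W.Δ p q (δ (p * q) h)
    = TensorProduct.map (δ p) LinearMap.id (W.Δ p q h)
      + TensorProduct.map (LinearMap.mulLeft k (r p)) (δ q) (W.Δ p q h)
  Δ_S : ∀ (p q : G) (h : H ((p * q)⁻¹)), W.Δ p q (W.invS (p * q) h)
    = TensorProduct.map (W.invS p) (W.invS q) (TensorProduct.comm k (H q⁻¹) (H p⁻¹)
        (W.Δ q⁻¹ p⁻¹ (lcast k (mul_inv_rev p q) h)))

namespace IsOreDatum

variable {W : GCHCQG k H} {χ : H (1 : G) →ₐ[k] k} {r : ∀ p : G, H p}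
  {τ : ∀ p : G, H p →ₐ[k] H p} {δ : ∀ p : G, H p →ₗ[k] H p}

theorem r_mul_invS (D : W.IsOreDatum χ r τ δ) (q : G) : r q * W.invS q (r q⁻¹) = 1 := by
  have h := W.mul_antipode q (r (q * q⁻¹))
  rwa [D.Δ_r, lcast_section, D.ε_r, map_one] at h

theorem invS_mul_r (D : W.IsOreDatum χ r τ δ) (q : G) : W.invS q (r q⁻¹) * r q = 1 := by
  have h : antipodeMap₁ (W.invS q) (TensorProduct.map LinearMap.id (W.Δ q 1).toLinearMap
      (W.Δ q⁻¹ (q * 1) (r _))) = _ := W.antipode_1 1 q (r (q⁻¹ * (q * 1)))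
  rw [D.Δ_r, TensorProduct.map_tmul, AlgHom.toLinearMap_apply, D.Δ_r, LinearMap.id_apply,
    antipodeMap₁_tmul, lcast_section] at h
  have h2 := congrArg (fun t => TensorProduct.rid k (H q)
    (TensorProduct.map LinearMap.id W.ε.toLinearMap t)) h
  simpa [D.ε_r] using h2

theorem invS_invS_r (D : W.IsOreDatum χ r τ δ) (q : G) :
    W.invS q (W.invS q⁻¹ (r q⁻¹⁻¹)) = r q := by
  have h := congrArg (W.invS q) (D.r_mul_invS q⁻¹)
  rw [invS_mul, invS_one] at h
  exact left_inv_eq_right_inv h (D.invS_mul_r q)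

theorem δ_one (D : W.IsOreDatum χ r τ δ) (p : G) : δ p 1 = 0 := by
  simpa using D.δ_mul p 1 1

theorem χ_invS_τ (D : W.IsOreDatum χ r τ δ) (g : H (1 : G)⁻¹) :
    χ (W.invS 1 (τ 1⁻¹ g)) = W.ε (lcast k inv_one g) := by
  have h := congrArg χ (W.mul_antipode 1 (lcast k (one_mul _).symm g))
  rw [AlgHom.commutes, lcast_lcast] at h
  refine Eq.trans ?_ h
  rw [D.τ_eq]
  generalize W.Δ 1 1⁻¹ _ = t
  induction t with
  | zero => simp
  | add x y hx hy => simp only [map_add, hx, hy]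
  | tmul a b => simp

theorem τ_invS_τ (D : W.IsOreDatum χ r τ δ) (q : G) (h : H q⁻¹) :
    τ q (W.invS q (τ q⁻¹ h)) = r q * W.invS q h * W.invS q (r q⁻¹) := by
  rw [D.τ_eq q, ← invS_lcast, D.Δ_S, lcast_lcast, ← map_lcast (fun p => τ p), D.Δ_τ_right]
  have key : ∀ t : H q⁻¹ ⊗[k] H (1 : G)⁻¹,
      TensorProduct.lid k (H q) (TensorProduct.map χ.toLinearMap LinearMap.id
        (TensorProduct.map (W.invS 1) (W.invS q) (TensorProduct.comm k (H q⁻¹) (H (1 : G)⁻¹)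
          (TensorProduct.map ((LinearMap.mulLeft k (r q⁻¹)).comp
            (LinearMap.mulRight k (W.invS q⁻¹ (r q⁻¹⁻¹)))) (τ 1⁻¹).toLinearMap t))))
      = r q * W.invS q (TensorProduct.rid k (H q⁻¹)
          (TensorProduct.map LinearMap.id (W.ε.toLinearMap ∘ₗ lcast k inv_one) t))
        * W.invS q (r q⁻¹) := by
    intro t
    induction t with
    | zero => simp
    | add x y hx hy => simp only [map_add, hx, hy, mul_add, add_mul]
    | tmul a b => simp [D.χ_invS_τ, invS_mul, D.invS_invS_r]
  rw [key, W.counit_right_of_eq_one inv_one, lcast_lcast, lcast_rfl, LinearMap.id_apply]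

theorem invS_δ (D : W.IsOreDatum χ r τ δ) (q : G) (h : H q⁻¹) :
    W.invS q (δ q⁻¹ h) = W.invS q (r q⁻¹) * δ q (W.invS q (τ q⁻¹ h)) := by
  let F : H q⁻¹ →ₗ[k] H q := W.invS q ∘ₗ δ q⁻¹
    - LinearMap.mulLeft k (W.invS q (r q⁻¹)) ∘ₗ δ q ∘ₗ W.invS q ∘ₗ (τ q⁻¹).toLinearMap
  refine sub_eq_zero.1 (W.eq_zero_of_convolution q F (fun x => ?_) h)
  have h1 := W.mul_antipode q (δ _ x)
  rw [← map_lcast (fun p => δ p), D.ε_δ, map_zero, D.Δ_δ] at h1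
  have h2 := congrArg (δ q) (W.mul_antipode q x)
  rw [Algebra.algebraMap_eq_smul_one, map_smul, D.δ_one, smul_zero] at h2
  have h3 := congrArg (fun t => LinearMap.mul' k (H q)
    (TensorProduct.map LinearMap.id (δ q ∘ₗ W.invS q) t))
    ((D.Δ_τ_left q q⁻¹ x).symm.trans (D.Δ_τ_right q q⁻¹ x))
  have key : ∀ t : H q ⊗[k] H q⁻¹,
      LinearMap.mul' k (H q) (TensorProduct.map LinearMap.id F t)
      = W.invS q (r q⁻¹) * (LinearMap.mul' k (H q) (TensorProduct.map LinearMap.id (W.invS q)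
            (TensorProduct.map (δ q) LinearMap.id t
              + TensorProduct.map (LinearMap.mulLeft k (r q)) (δ q⁻¹) t))
          - δ q (LinearMap.mul' k (H q) (TensorProduct.map LinearMap.id (W.invS q) t))
          + (LinearMap.mul' k (H q) (TensorProduct.map LinearMap.id (δ q ∘ₗ W.invS q)
              (TensorProduct.map (τ q).toLinearMap LinearMap.id t))
            - LinearMap.mul' k (H q) (TensorProduct.map LinearMap.id (δ q ∘ₗ W.invS q)
              (TensorProduct.map ((LinearMap.mulLeft k (r q)).comp
                (LinearMap.mulRight k (W.invS q (r q⁻¹)))) (τ q⁻¹).toLinearMap t)))) := by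
    intro t
    induction t with
    | zero => simp
    | add x y hx hy =>
      simp only [map_add, hx, hy, ← mul_add]
      congr 1
      abel
    | tmul a b =>
      have h5 : ∀ z, W.invS q (r q⁻¹) * (r q * z) = z := fun z => by
        rw [← mul_assoc, D.invS_mul_r, one_mul]
      simp [F, D.δ_mul, mul_sub, h5, mul_assoc]
  rw [key, h1, h2, h3]
  simp

end IsOreDatum

end GCHCQG

namespace GCHCQG.IsOreDatum

variable {k : Type*} [Field k] {G : Type*} [Group G] {H : G → Type*}
  [∀ p, Ring (H p)] [∀ p, Algebra k (H p)]
  {W : GCHCQG k H} {χ : H (1 : G) →ₐ[k] k} {r : ∀ p : G, H p}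
  {τ : ∀ p : G, H p →ₐ[k] H p} {δ : ∀ p : G, H p →ₗ[k] H p}
  {R : G → Type*} [∀ p, Ring (R p)] [∀ p, Algebra k (R p)]

theorem exists_Δ (D : W.IsOreDatum χ r τ δ) (ore : ∀ p : G, OreData k (H p) (R p) (τ p) (δ p))
    (p q : G) : ∃ F : R (p * q) →ₐ[k] R p ⊗[k] R q,
      (∀ h, F ((ore (p * q)).ι h)
        = TensorProduct.map ((ore p).ι).toLinearMap ((ore q).ι).toLinearMap (W.Δ p q h)) ∧
      F (ore (p * q)).y = (ore p).y ⊗ₜ[k] (1 : R q) + (ore p).ι (r p) ⊗ₜ[k] (ore q).y := by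
  refine (ore (p * q)).exists_lift
    ((Algebra.TensorProduct.map (ore p).ι (ore q).ι).comp (W.Δ p q)) _ fun a => ?_
  simp only [AlgHom.comp_apply]
  rw [mul_add]
  nth_rewrite 1 [D.Δ_τ_left]
  rw [D.Δ_τ_right, D.Δ_δ]
  generalize W.Δ p q a = t
  induction t with
  | zero => simp
  | add x y hx hy =>
    simp only [map_add, mul_add, add_mul] at hx hy ⊢
    rw [hx, hy]
    abel
  | tmul a b =>
    simp only [Algebra.TensorProduct.map_tmul, TensorProduct.map_tmul, map_add,
      Algebra.TensorProduct.tmul_mul_tmul, add_mul, (ore _).rel, LinearMap.id_apply, mul_one,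
      one_mul, TensorProduct.add_tmul, TensorProduct.tmul_add, AlgHom.toLinearMap_apply,
      LinearMap.comp_apply, LinearMap.mulLeft_apply, LinearMap.mulRight_apply, ← map_mul,
      mul_assoc, D.invS_mul_r]
    abel

theorem exists_ε (D : W.IsOreDatum χ r τ δ) (O : OreData k (H 1) (R 1) (τ 1) (δ 1)) :
    ∃ F : R 1 →ₐ[k] k, (∀ h, F (O.ι h) = W.ε h) ∧ F O.y = 0 :=
  O.exists_lift W.ε 0 fun a => by simp [D.ε_δ]

theorem S_eq (D : W.IsOreDatum χ r τ δ) (O : ∀ p : G, OreData k (H p) (R p) (τ p) (δ p)) (q : G)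
    (h : H q⁻¹) :
    (O q).ι (W.invS q h) * -((O q).ι (W.invS q (r q⁻¹)) * (O q).y)
      = -((O q).ι (W.invS q (r q⁻¹)) * (O q).y) * (O q).ι (W.invS q (τ q⁻¹ h))
        + (O q).ι (W.invS q (δ q⁻¹ h)) := by
  rw [neg_mul, mul_assoc _ _ ((O q).ι _), (O q).rel, D.τ_invS_τ, D.invS_δ, mul_add, neg_add,
    ← mul_assoc ((O q).ι _), ← map_mul, ← map_mul, mul_assoc (r q), ← mul_assoc (W.invS q _) (r q),
    D.invS_mul_r, one_mul, neg_add_cancel_right, mul_neg, ← mul_assoc, ← map_mul]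

theorem exists_S (D : W.IsOreDatum χ r τ δ) (ore : ∀ p : G, OreData k (H p) (R p) (τ p) (δ p))
    (p : G) : ∃ F : R p →ₗ[k] R p⁻¹, F 1 = 1 ∧ (∀ a b, F (a * b) = F b * F a) ∧
      (∀ h, F ((ore p).ι h) = (ore p⁻¹).ι (W.S p h)) ∧
      F (ore p).y = -((ore p⁻¹).ι (W.S p (r p)) * (ore p⁻¹).y) := by
  let f : H p →ₐ[k] (R p⁻¹)ᵐᵒᵖ := AlgHom.ofLinearMap
    ((MulOpposite.opLinearEquiv k).toLinearMap ∘ₗ (ore p⁻¹).ι.toLinearMap ∘ₗ W.S p)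
    (by simp [W.S_one]) (by intro a b; simp [W.S_mul])
  obtain ⟨F, hFι, hFy⟩ := (ore p).exists_lift f
    (MulOpposite.op (-((ore p⁻¹).ι (W.S p (r p)) * (ore p⁻¹).y))) (fun a => by
      have h := D.S_eq ore p⁻¹ (lcast k (inv_inv p).symm a)
      rw [map_lcast (fun p => τ p), map_lcast (fun p => δ p),
        ← lcast_section (k := k) r (inv_inv p).symm,
        ← S_eq_invS, ← S_eq_invS, ← S_eq_invS, ← S_eq_invS] at h
      exact congrArg MulOpposite.op h)
  refine ⟨(MulOpposite.opLinearEquiv k).symm.toLinearMap ∘ₗ F.toLinearMap, by simp, by simp,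
    fun h => ?_, ?_⟩
  · simp only [LinearMap.comp_apply, AlgHom.toLinearMap_apply, hFι]
    rfl
  · simp [hFy]

/-- The `G`-cograded Hopf coquasigroup structure on the Ore extensions. -/
theorem exists_extension (D : W.IsOreDatum χ r τ δ)
    (ore : ∀ p : G, OreData k (H p) (R p) (τ p) (δ p)) :
    ∃ RR : GCHCQG k R,
      (∀ (p q : G) (h : H (p * q)), RR.Δ p q ((ore (p * q)).ι h)
        = TensorProduct.map ((ore p).ι).toLinearMap ((ore q).ι).toLinearMap (W.Δ p q h)) ∧
      (∀ h : H (1 : G), RR.ε ((ore 1).ι h) = W.ε h) ∧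
      (∀ (p : G) (h : H p), RR.S p ((ore p).ι h) = (ore p⁻¹).ι (W.S p h)) ∧
      (∀ p q : G, RR.Δ p q ((ore (p * q)).y)
        = (ore p).y ⊗ₜ[k] (1 : R q) + (ore p).ι (r p) ⊗ₜ[k] (ore q).y) ∧
      RR.ε ((ore 1).y) = 0 ∧
      ∀ p : G, lcast k (inv_inv p) (RR.S p⁻¹ ((ore p⁻¹).y))
        = -((ore p).ι (W.invS p (r p⁻¹)) * (ore p).y) := by
  choose Δ hΔι hΔy using D.exists_Δ ore
  obtain ⟨ε, hει, hεy⟩ := D.exists_ε (ore 1)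
  choose S hS1 hSmul hSι hSy using D.exists_S ore
  have lι : ∀ {p q : G} (e : p = q) (h : H p),
      lcast k e ((ore p).ι h) = (ore q).ι (lcast k e h) := fun e h =>
    (map_lcast (fun p => (ore p).ι) e h).symm
  have ly : ∀ {p q : G} (e : p = q), lcast k e (ore p).y = (ore q).y := fun e =>
    lcast_section (fun p => (ore p).y) e
  have lmul : ∀ {p q : G} (e : p = q) (a b : R p),
      lcast k e (a * b) = lcast k e a * lcast k e b := fun e a b =>
    map_mul (lcastAlgHom (k := k) e) a b
  let s : ∀ q : G, R q⁻¹ →ₗ[k] R q := fun q => (lcast k (inv_inv q)).comp (S q⁻¹)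
  have hs1 : ∀ q, s q 1 = 1 := fun q => by
    simp only [s, LinearMap.comp_apply, hS1]
    exact map_one (lcastAlgHom (k := k) (inv_inv q))
  have hsmul : ∀ q a b, s q (a * b) = s q b * s q a := fun q a b => by
    simp only [s, LinearMap.comp_apply, hSmul, lmul]
  have hsι : ∀ q h, s q ((ore q⁻¹).ι h) = (ore q).ι (W.invS q h) := fun q h => by
    simp only [s, LinearMap.comp_apply, hSι, lι, invS]
  have hsy : ∀ q, s q (ore q⁻¹).y = -((ore q).ι (W.invS q (r q⁻¹)) * (ore q).y) := fun q => by
    simp only [s, LinearMap.comp_apply, hSy, map_neg, lmul, lι, ly, invS]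
  have rs : ∀ q (z : R q), (ore q).ι (r q) * ((ore q).ι (W.invS q (r q⁻¹)) * z) = z :=
    fun q z => by rw [← mul_assoc, ← map_mul, D.r_mul_invS, map_one, one_mul]
  have hΘι₁ : ∀ p q s h, TensorProduct.map LinearMap.id (Δ q s).toLinearMap
      (Δ p (q * s) ((ore _).ι h)) = TensorProduct.map (ore p).ι.toLinearMap
        (TensorProduct.map (ore q).ι.toLinearMap (ore s).ι.toLinearMap)
        (TensorProduct.map LinearMap.id (W.Δ q s).toLinearMap (W.Δ p (q * s) h)) := by
    intro p q s h
    rw [hΔι]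
    generalize W.Δ p (q * s) h = t
    induction t with
    | zero => simp
    | add x y hx hy => simp only [map_add, hx, hy]
    | tmul a b => simp [hΔι]
  have hΘι₂ : ∀ p q s h, TensorProduct.map (Δ p q).toLinearMap LinearMap.id
      (Δ (p * q) s ((ore _).ι h)) = TensorProduct.map
        (TensorProduct.map (ore p).ι.toLinearMap (ore q).ι.toLinearMap) (ore s).ι.toLinearMap
        (TensorProduct.map (W.Δ p q).toLinearMap LinearMap.id (W.Δ (p * q) s h)) := by
    intro p q s h
    rw [hΔι]
    generalize W.Δ (p * q) s h = t
    induction t with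
    | zero => simp
    | add x y hx hy => simp only [map_add, hx, hy]
    | tmul a b => simp [hΔι]
  have hΘy₁ : ∀ p q s, TensorProduct.map LinearMap.id (Δ q s).toLinearMap
      (Δ p (q * s) (ore _).y) = (ore p).y ⊗ₜ (1 ⊗ₜ 1) + (ore p).ι (r p) ⊗ₜ ((ore q).y ⊗ₜ[k] 1)
        + (ore p).ι (r p) ⊗ₜ ((ore q).ι (r q) ⊗ₜ (ore s).y) := by
    intro p q s
    simp [hΔy, TensorProduct.tmul_add, add_assoc, Algebra.TensorProduct.one_def]
  have hΘy₂ : ∀ p q s, TensorProduct.map (Δ p q).toLinearMap LinearMap.id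
      (Δ (p * q) s (ore _).y) = ((ore p).y ⊗ₜ 1) ⊗ₜ 1 + ((ore p).ι (r p) ⊗ₜ (ore q).y) ⊗ₜ[k] 1
        + ((ore p).ι (r p) ⊗ₜ (ore q).ι (r q)) ⊗ₜ (ore s).y := by
    intro p q s
    simp [hΔy, hΔι, D.Δ_r, TensorProduct.add_tmul]
  have hΘmul₁ : ∀ p q s (x z : R (p * (q * s))),
      TensorProduct.map LinearMap.id (Δ q s).toLinearMap (Δ p (q * s) (x * z))
      = TensorProduct.map LinearMap.id (Δ q s).toLinearMap (Δ p (q * s) x)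
        * TensorProduct.map LinearMap.id (Δ q s).toLinearMap (Δ p (q * s) z) := fun p q s =>
    map_mul ((Algebra.TensorProduct.map (AlgHom.id k (R p)) (Δ q s)).comp (Δ p (q * s)))
  have hΘmul₂ : ∀ p q s (x z : R ((p * q) * s)),
      TensorProduct.map (Δ p q).toLinearMap LinearMap.id (Δ (p * q) s (x * z))
      = TensorProduct.map (Δ p q).toLinearMap LinearMap.id (Δ (p * q) s x)
        * TensorProduct.map (Δ p q).toLinearMap LinearMap.id (Δ (p * q) s z) := fun p q s =>
    map_mul ((Algebra.TensorProduct.map (Δ p q) (AlgHom.id k (R s))).comp (Δ (p * q) s))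
  refine ⟨{
    Δ := Δ
    ε := ε
    S := S
    S_one := hS1
    S_mul := hSmul
    counit_left := fun p x => ?_
    counit_right := fun p x => ?_
    antipode_1 := fun p q x => ?_
    antipode_2 := fun p q x => ?_
    antipode_3 := fun p q x => ?_
    antipode_4 := fun p q x => ?_ }, hΔι, hει, hSι, hΔy, hεy, hsy⟩
  · induction x using (ore _).induction with
    | hι h =>
      rw [hΔι, lι, ← W.counit_left]
      generalize W.Δ 1 p h = t
      induction t with
      | zero => simp
      | add x y hx hy => simp only [map_add, hx, hy]
      | tmul a b => simp [hει]
    | hy => simp [hΔy, hει, hεy, D.ε_r, ly]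
    | hadd x z hx hz => simp only [map_add, hx, hz]
    | hmul x z hx hz =>
      rw [lmul, ← hx, ← hz]
      exact map_mul ((Algebra.TensorProduct.lid k (R p)).toAlgHom.comp
        ((Algebra.TensorProduct.map ε (AlgHom.id k (R p))).comp (Δ 1 p))) x z
  · induction x using (ore _).induction with
    | hι h =>
      rw [hΔι, lι, ← W.counit_right]
      generalize W.Δ p 1 h = t
      induction t with
      | zero => simp
      | add x y hx hy => simp only [map_add, hx, hy]
      | tmul a b => simp [hει]
    | hy => simp [hΔy, hεy, ly]
    | hadd x z hx hz => simp only [map_add, hx, hz]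
    | hmul x z hx hz =>
      rw [lmul, ← hx, ← hz]
      exact map_mul ((Algebra.TensorProduct.rid k k (R p)).toAlgHom.comp
        ((Algebra.TensorProduct.map (AlgHom.id k (R p)) ε).comp (Δ p 1))) x z
  · change antipodeMap₁ (s q) (TensorProduct.map LinearMap.id (Δ q p).toLinearMap _) = _
    induction x using (ore _).induction with
    | hι h =>
      rw [hΘι₁, antipodeMap₁_map _ _ _ (W.invS q) _ (hsι q)]
      exact (congrArg _ (W.antipode_1 p q h)).trans (by simp [lι])
    | hy =>
      simp [hΘy₁, hsι, hsy, ly, ← map_mul, D.invS_mul_r, TensorProduct.neg_tmul]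
    | hadd x z hx hz => simp only [map_add, hx, hz, TensorProduct.tmul_add]
    | hmul x z hx hz => rw [hΘmul₁, antipodeMap₁_mul _ (hsmul q) hx, hz]; simp [lmul]
  · change antipodeMap₂ (s q) (TensorProduct.map LinearMap.id (Δ q⁻¹ p).toLinearMap _) = _
    induction x using (ore _).induction with
    | hι h =>
      rw [hΘι₁, antipodeMap₂_map _ _ _ (W.invS q) _ (hsι q)]
      exact (congrArg _ (W.antipode_2 p q h)).trans (by simp [lι])
    | hy =>
      simp [hΘy₁, hsι, hsy, ly, ← map_mul, D.r_mul_invS, hs1, rs, TensorProduct.neg_tmul]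
    | hadd x z hx hz => simp only [map_add, hx, hz, TensorProduct.tmul_add]
    | hmul x z hx hz => rw [hΘmul₁, antipodeMap₂_mul _ (hsmul q) _ hz, hx]; simp [lmul]
  · change antipodeMap₃ (s q) (TensorProduct.map (Δ p q).toLinearMap LinearMap.id _) = _
    induction x using (ore _).induction with
    | hι h =>
      rw [hΘι₂, antipodeMap₃_map _ _ _ (W.invS q) _ (hsι q)]
      exact (congrArg _ (W.antipode_3 p q h)).trans (by simp [lι])
    | hy =>
      simp [hΘy₂, hsy, ly, hs1, rs, TensorProduct.tmul_neg]
    | hadd x z hx hz => simp only [map_add, hx, hz, TensorProduct.add_tmul]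
    | hmul x z hx hz => rw [hΘmul₂, antipodeMap₃_mul _ (hsmul q) _ hz, hx]; simp [lmul]
  · change antipodeMap₄ (s q) (TensorProduct.map (Δ p q⁻¹).toLinearMap LinearMap.id _) = _
    induction x using (ore _).induction with
    | hι h =>
      rw [hΘι₂, antipodeMap₄_map _ _ _ (W.invS q) _ (hsι q)]
      exact (congrArg _ (W.antipode_4 p q h)).trans (by simp [lι])
    | hy =>
      simp [hΘy₂, hsι, hsy, ly, hs1, TensorProduct.tmul_neg]
    | hadd x z hx hz => simp only [map_add, hx, hz, TensorProduct.add_tmul]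
    | hmul x z hx hz => rw [hΘmul₂, antipodeMap₄_mul _ (hsmul q) hx, hz]; simp [lmul]

end GCHCQG.IsOreDatum

/-- Theorem 4.3, sufficiency: Given a character `χ`, grouplike family
`r` (with `ε(r_1)=1`, so `r_p⁻¹ = S_{p⁻¹}(r_{p⁻¹})`), `τ_p(h) = χ(h_(1,1))h_(2,p)`,
`τ_p`-derivations `δ_p` with `ε ∘ δ_1 = 0`, the compatibilities (D2), (D3), and
anti-comultiplicativity of the antipode, the family of Ore extensions
`(H_p[y_p; τ_p, δ_p])` admits a `G`-cograded Hopf coquasigroup structure extending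
that of `H`, with `Δ(y_{pq}) = y_p ⊗ 1_q + r_p ⊗ y_q`, `ε(y_1) = 0` and
`S_{p⁻¹}(y_{p⁻¹}) = −r_p⁻¹ y_p`. -/
theorem statement11 (k : Type*) [Field k] {G : Type*} [Group G]
    (H : G → Type*) [∀ p, Ring (H p)] [∀ p, Algebra k (H p)]
    (W : GCHCQG k H)
    (χ : H (1 : G) →ₐ[k] k)
    (r : ∀ p : G, H p)
    (hΔr : ∀ p q : G, W.Δ p q (r (p * q)) = r p ⊗ₜ[k] r q)
    (hεr : W.ε (r 1) = 1)
    (τ : ∀ p : G, H p →ₐ[k] H p)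
    (hτ : ∀ (p : G) (h : H p),
      τ p h
        = TensorProduct.lid k (H p)
            (TensorProduct.map χ.toLinearMap LinearMap.id
              (W.Δ 1 p (lcast k (one_mul p).symm h))))
    (δ : ∀ p : G, H p →ₗ[k] H p)
    (hder : ∀ (p : G) (a b : H p), δ p (a * b) = δ p a * b + τ p a * δ p b)
    (hεδ : ∀ h : H (1 : G), W.ε (δ 1 h) = 0)
    (hD2 : ∀ (p q : G) (h : H (p * q)),
      (TensorProduct.lid k (H p ⊗[k] H q)
          (TensorProduct.map χ.toLinearMap (W.Δ p q).toLinearMap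
            (W.Δ 1 (p * q) (lcast k (one_mul (p * q)).symm h)))
        = TensorProduct.map
            ((LinearMap.mulLeft k (r p)).comp
              (LinearMap.mulRight k (lcast k (inv_inv p) (W.S p⁻¹ (r p⁻¹)))))
            ((TensorProduct.lid k (H q)).toLinearMap ∘ₗ
              TensorProduct.map χ.toLinearMap LinearMap.id ∘ₗ
              (W.Δ 1 q).toLinearMap ∘ₗ lcast k (one_mul q).symm)
            (W.Δ p q h)) ∧
      (TensorProduct.map
            ((LinearMap.mulLeft k (r p)).comp
              (LinearMap.mulRight k (lcast k (inv_inv p) (W.S p⁻¹ (r p⁻¹)))))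
            ((TensorProduct.lid k (H q)).toLinearMap ∘ₗ
              TensorProduct.map χ.toLinearMap LinearMap.id ∘ₗ
              (W.Δ 1 q).toLinearMap ∘ₗ lcast k (one_mul q).symm)
            (W.Δ p q h)
        = TensorProduct.map
            ((TensorProduct.lid k (H p)).toLinearMap ∘ₗ
              TensorProduct.map χ.toLinearMap LinearMap.id ∘ₗ
              (W.Δ 1 p).toLinearMap ∘ₗ lcast k (one_mul p).symm)
            LinearMap.id (W.Δ p q h)))
    (hD3 : ∀ (p q : G) (h : H (p * q)),
      W.Δ p q (δ (p * q) h)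
        = TensorProduct.map (δ p) LinearMap.id (W.Δ p q h)
          + TensorProduct.map (LinearMap.mulLeft k (r p)) (δ q) (W.Δ p q h))
    (hS : ∀ (p q : G) (h : H ((p * q)⁻¹)),
      W.Δ p q (lcast k (inv_inv (p * q)) (W.S (p * q)⁻¹ h))
        = TensorProduct.map
            ((lcast k (inv_inv p)).comp (W.S p⁻¹))
            ((lcast k (inv_inv q)).comp (W.S q⁻¹))
            (TensorProduct.comm k (H q⁻¹) (H p⁻¹)
              (W.Δ q⁻¹ p⁻¹ (lcast k (mul_inv_rev p q) h))))
    (R : G → Type*) [∀ p, Ring (R p)] [∀ p, Algebra k (R p)]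
    (ore : ∀ p : G, OreData k (H p) (R p) (τ p) (δ p)) :
    ∃ RR : GCHCQG k R,
      (∀ (p q : G) (h : H (p * q)),
        RR.Δ p q ((ore (p * q)).ι h)
          = TensorProduct.map ((ore p).ι).toLinearMap ((ore q).ι).toLinearMap
              (W.Δ p q h)) ∧
      (∀ h : H (1 : G), RR.ε ((ore 1).ι h) = W.ε h) ∧
      (∀ (p : G) (h : H p), RR.S p ((ore p).ι h) = (ore p⁻¹).ι (W.S p h)) ∧
      (∀ p q : G,
        RR.Δ p q ((ore (p * q)).y)
          = (ore p).y ⊗ₜ[k] (1 : R q) + (ore p).ι (r p) ⊗ₜ[k] (ore q).y) ∧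
      (RR.ε ((ore 1).y) = 0) ∧
      (∀ p : G,
        lcast k (inv_inv p) (RR.S p⁻¹ ((ore p⁻¹).y))
          = - ((ore p).ι (lcast k (inv_inv p) (W.S p⁻¹ (r p⁻¹))) * (ore p).y)) := by
  have hτ' : ∀ p : G, (TensorProduct.lid k (H p)).toLinearMap ∘ₗ
      TensorProduct.map χ.toLinearMap LinearMap.id ∘ₗ
      (W.Δ 1 p).toLinearMap ∘ₗ lcast k (one_mul p).symm = (τ p).toLinearMap := fun p =>
    LinearMap.ext fun h => (hτ p h).symm
  have hΔτ : ∀ (p q : G) (h : H (p * q)), W.Δ p q (τ (p * q) h)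
      = TensorProduct.map ((LinearMap.mulLeft k (r p)).comp
        (LinearMap.mulRight k (W.invS p (r p⁻¹)))) (τ q).toLinearMap (W.Δ p q h) := by
    intro p q h
    rw [← hτ' q]
    refine Eq.trans ?_ (hD2 p q h).1
    rw [hτ]
    generalize W.Δ 1 (p * q) _ = t
    induction t with
    | zero => simp
    | add x y hx hy => simp only [map_add, hx, hy]
    | tmul a b => simp
  have D : W.IsOreDatum χ r τ δ :=
    { Δ_r := hΔr
      ε_r := hεr
      τ_eq := hτ
      Δ_τ_left := fun p q h => by
        rw [hΔτ, ← hτ' p, ← hτ' q]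
        exact (hD2 p q h).2
      Δ_τ_right := hΔτ
      δ_mul := hder
      ε_δ := hεδ
      Δ_δ := hD3
      Δ_S := hS }
  exact D.exists_extension ore
end

section
/- Let H = (H_p)_{p in G} be a G-cograded Hopf coquasigroup, χ : H_1 → k a k-algebra homomorphism, and r_p in H_p a family of invertible elements with S_{p⁻¹}(r_{p⁻¹}) = r_p⁻¹ for all p. Define τ_p : H_p → H_p by τ_p(h) = χ(h_(1,1))h_(2,p) and let δ_p : H_p → H_p be τ_p-derivations with ε(δ_1(h)) = 0 for all h in H_1. Assume that for all p,q in G and h in H_{pq}: χ(h_(1,1))h_(21,p) ⊗ h_(22,q) = r_p h_(1,p) r_p⁻¹ χ(h_(21,1)) ⊗ h_(22,q) = χ(h_(11,1))h_(12,p) ⊗ h_(2,q), and Δ_{p,q}(δ_{pq}(h)) = δ_p(h_(1,p)) ⊗ h_(2,q) + r_p h_(1,p) ⊗ δ_q(h_(2,q)); assume also the antipode is anti-comultiplicative: Δ_{p,q}(S_{(pq)⁻¹}(h)) = S_{p⁻¹}(h_(2,p⁻¹)) ⊗ S_{q⁻¹}(h_(1,q⁻¹)) for all h in H_{(pq)⁻¹}.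 Then for every p in G and h in H_p: r_{p⁻¹}·S_p(δ_p(h)) = χ(h_(1,1))·δ_{p⁻¹}(S_p(h_(2,p))) = δ_{p⁻¹}(S_p(τ_p(h))), where Δ_{1,p}(h) = h_(1,1) ⊗ h_(2,p). -/
open scoped TensorProduct

lemma lcast_lcast_self {k G : Type*} [Field k] {H : G → Type*} [∀ p, AddCommMonoid (H p)]
    [∀ p, Module k (H p)] {p q : G} (e : p = q) (e' : q = p) (h : H p) :
    lcast k e' (lcast k e h) = h := by
  subst e
  rfl

namespace GCHCQG

open TensorProduct

variable {k : Type*} [Field k] {G : Type*} [Group G]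
  {H : G → Type*} [∀ p, Ring (H p)] [∀ p, Algebra k (H p)]

/-- The comultiplication `H_s → H_p ⊗ H_q` for any `s` equal to `pq`. -/
def comulOf (W : GCHCQG k H) (p q s : G) (e : s = p * q) : H s →ₗ[k] H p ⊗[k] H q :=
  (W.Δ p q).toLinearMap ∘ₗ lcast k e

/-- The antipode `H_p → H_q` for any `q` equal to `p⁻¹`. -/
def antipodeTo (W : GCHCQG k H) (p q : G) (e : p⁻¹ = q) : H p →ₗ[k] H q :=
  lcast k e ∘ₗ W.S p

lemma comulOf_one (W : GCHCQG k H) (p q s : G) (e : s = p * q) :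
    W.comulOf p q s e 1 = 1 ⊗ₜ 1 := by
  subst e
  exact map_one (W.Δ p q)

lemma antipodeTo_mul (W : GCHCQG k H) (p q : G) (e : p⁻¹ = q) (a b : H p) :
    W.antipodeTo p q e (a * b) = W.antipodeTo p q e b * W.antipodeTo p q e a := by
  subst e
  exact W.S_mul p a b

lemma antipodeTo_one (W : GCHCQG k H) (p q : G) (e : p⁻¹ = q) :
    W.antipodeTo p q e 1 = 1 := by
  subst e
  exact W.S_one p

lemma rid_map_counit_comulOf (W : GCHCQG k H) (p s : G) (e : s = p * 1) (h : H s) :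
    TensorProduct.rid k (H p) (map LinearMap.id W.ε.toLinearMap (W.comulOf p 1 s e h))
      = lcast k (e.trans (mul_one p)) h := by
  subst e
  exact W.counit_right p h

/-- `S(h₁)h₂ = ε(h)1` on `H_1`. -/
lemma mul_antipodeTo_left (W : GCHCQG k H) (p q : G) (e : p⁻¹ = q) (e' : 1 = p * q) (h : H 1) :
    LinearMap.mul' k (H q) (map (W.antipodeTo p q e) LinearMap.id (W.comulOf p q 1 e' h))
      = W.ε h • 1 := by
  obtain rfl : p = q⁻¹ := by rw [← e, inv_inv]
  have key : ∀ (s : G) (e₁ : s = q * 1) (e₂ : 1 = q⁻¹ * s),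
      map (LinearMap.mul' k (H q)) LinearMap.id
        (map (map (W.antipodeTo q⁻¹ q e) LinearMap.id) LinearMap.id
          ((TensorProduct.assoc k (H q⁻¹) (H q) (H 1)).symm
            (map LinearMap.id (W.comulOf q 1 s e₁) (W.comulOf q⁻¹ s 1 e₂ h))))
        = (1 : H q) ⊗ₜ[k] h := by
    intro s e₁ e₂
    subst e₁
    have := W.antipode_1 1 q (lcast k e₂ h)
    refine this.trans ?_
    rw [lcast_lcast_self]
  have := congrArg (fun t => TensorProduct.rid k (H q) (map LinearMap.id W.ε.toLinearMap t))
    (key q (mul_one q).symm e')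
  simp only [map_tmul, LinearMap.id_coe, id_eq, TensorProduct.rid_tmul,
    AlgHom.toLinearMap_apply] at this
  rw [← this]
  generalize W.comulOf q⁻¹ q 1 e' h = t
  induction t with
  | zero => simp
  | add x y hx hy => simp only [map_add, hx, hy]
  | tmul x y =>
    have hy := W.rid_map_counit_comulOf q q (mul_one q).symm y
    change _ = y at hy
    simp only [map_tmul, LinearMap.id_coe, id_eq]
    nth_rewrite 1 [← hy]
    generalize W.comulOf q 1 q _ y = u
    induction u with
    | zero => simp
    | add x y hx hy => simp only [map_add, tmul_add, hx, hy]
    | tmul a b => simp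

/-- `h₁S(h₂) = ε(h)1` on `H_1`. -/
lemma mul_antipodeTo_right (W : GCHCQG k H) (p q : G) (e : p⁻¹ = q) (e' : 1 = q * p) (h : H 1) :
    LinearMap.mul' k (H q) (map LinearMap.id (W.antipodeTo p q e) (W.comulOf q p 1 e' h))
      = W.ε h • 1 := by
  obtain rfl : p = q⁻¹ := by rw [← e, inv_inv]
  have key : ∀ (s : G) (e₁ : s = q⁻¹ * 1) (e₂ : 1 = q * s),
      map (LinearMap.mul' k (H q)) LinearMap.id
        (map (map LinearMap.id (W.antipodeTo q⁻¹ q e)) LinearMap.id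
          ((TensorProduct.assoc k (H q) (H q⁻¹) (H 1)).symm
            (map LinearMap.id (W.comulOf q⁻¹ 1 s e₁) (W.comulOf q s 1 e₂ h))))
        = (1 : H q) ⊗ₜ[k] h := by
    intro s e₁ e₂
    subst e₁
    have := W.antipode_2 1 q (lcast k e₂ h)
    refine this.trans ?_
    rw [lcast_lcast_self]
  have := congrArg (fun t => TensorProduct.rid k (H q) (map LinearMap.id W.ε.toLinearMap t))
    (key q⁻¹ (mul_one q⁻¹).symm e')
  simp only [map_tmul, LinearMap.id_coe, id_eq, TensorProduct.rid_tmul,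
    AlgHom.toLinearMap_apply] at this
  rw [← this]
  generalize W.comulOf q q⁻¹ 1 e' h = t
  induction t with
  | zero => simp
  | add x y hx hy => simp only [map_add, hx, hy]
  | tmul x y =>
    have hy := W.rid_map_counit_comulOf q⁻¹ q⁻¹ (mul_one q⁻¹).symm y
    change _ = y at hy
    simp only [map_tmul, LinearMap.id_coe, id_eq]
    nth_rewrite 1 [← hy]
    generalize W.comulOf q⁻¹ 1 q⁻¹ _ y = u
    induction u with
    | zero => simp
    | add x y hx hy => simp only [map_add, tmul_add, hx, hy]
    | tmul a b => simp

/-- `h₁₁ ⊗ h₁₂S(h₂) = h ⊗ 1`, with `h₁ ∈ H_1`. -/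
lemma comulOf_mul_antipodeTo (W : GCHCQG k H) (p q : G) (e : p⁻¹ = q) (e' : 1 = p * q) (h : H p) :
    map LinearMap.id (LinearMap.mul' k (H q))
      (map LinearMap.id (map LinearMap.id (W.antipodeTo p q e))
        (TensorProduct.assoc k (H p) (H q) (H p)
          (map (W.comulOf p q 1 e') LinearMap.id (W.comulOf 1 p p (one_mul p).symm h))))
      = h ⊗ₜ[k] (1 : H q) := by
  obtain rfl : p = q⁻¹ := by rw [← e, inv_inv]
  have key : ∀ (s : G) (e₁ : s = q⁻¹ * q) (e₂ : q⁻¹ = s * q⁻¹),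
      map LinearMap.id (LinearMap.mul' k (H q))
      (map LinearMap.id (map LinearMap.id (W.antipodeTo q⁻¹ q e))
        (TensorProduct.assoc k (H q⁻¹) (H q) (H q⁻¹)
          (map (W.comulOf q⁻¹ q s e₁) LinearMap.id (W.comulOf s q⁻¹ q⁻¹ e₂ h))))
      = h ⊗ₜ[k] (1 : H q) := by
    intro s e₁ e₂
    subst e₁
    have := W.antipode_3 q⁻¹ q (lcast k e₂ h)
    refine this.trans ?_
    rw [lcast_lcast_self]
  exact key 1 e' _

variable (W : GCHCQG k H) (χ : H 1 →ₐ[k] k) (r : ∀ p, (H p)ˣ) (τ δ : ∀ p, H p →ₗ[k] H p)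

lemma comulOf_antipodeTo
    (hS : ∀ (p q : G) (h : H ((p * q)⁻¹)),
      W.Δ p q (lcast k (inv_inv (p * q)) (W.S (p * q)⁻¹ h))
        = map ((lcast k (inv_inv p)).comp (W.S p⁻¹)) ((lcast k (inv_inv q)).comp (W.S q⁻¹))
            (TensorProduct.comm k (H q⁻¹) (H p⁻¹)
              (W.Δ q⁻¹ p⁻¹ (lcast k (mul_inv_rev p q) h))))
    {a b s a' b' s' : G} (ea : a⁻¹ = a') (eb : b⁻¹ = b') (es : s⁻¹ = s')
    (e : s = a * b) (e' : s' = b' * a') (h : H s) :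
    W.comulOf b' a' s' e' (W.antipodeTo s s' es h)
      = map (W.antipodeTo b b' eb) (W.antipodeTo a a' ea)
          (TensorProduct.comm k (H a) (H b) (W.comulOf a b s e h)) := by
  subst e'
  obtain rfl : a = a'⁻¹ := by rw [← ea, inv_inv]
  obtain rfl : b = b'⁻¹ := by rw [← eb, inv_inv]
  obtain rfl : s = (b' * a')⁻¹ := by rw [← es, inv_inv]
  exact hS b' a' h

lemma antipodeTo_unit
    (hSr : ∀ p, lcast k (inv_inv p) (W.S p⁻¹ (r p⁻¹ : H p⁻¹)) = (((r p)⁻¹ : (H p)ˣ) : H p))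
    {p q : G} (e : p⁻¹ = q) :
    W.antipodeTo p q e (r p) = (((r q)⁻¹ : (H q)ˣ) : H q) := by
  obtain rfl : p = q⁻¹ := by rw [← e, inv_inv]
  exact hSr q

lemma antipodeTo_unit_inv
    (hSr : ∀ p, lcast k (inv_inv p) (W.S p⁻¹ (r p⁻¹ : H p⁻¹)) = (((r p)⁻¹ : (H p)ˣ) : H p))
    {p q : G} (e : p⁻¹ = q) :
    W.antipodeTo p q e (((r p)⁻¹ : (H p)ˣ) : H p) = r q := by
  have h := W.antipodeTo_mul p q e (((r p)⁻¹ : (H p)ˣ) : H p) (r p)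
  rw [Units.inv_mul, antipodeTo_one, W.antipodeTo_unit r hSr e] at h
  exact (Units.inv_mul_eq_one.mp h.symm).symm

/-- `χ` composed with the antipode is a one-sided convolution inverse of `χ` on `H_1`. -/
lemma character_antipodeTo_twist
    (hτ : ∀ p h, τ p h = TensorProduct.lid k (H p)
      (map χ.toLinearMap LinearMap.id (W.comulOf 1 p p (one_mul p).symm h))) (h : H 1) :
    χ (W.antipodeTo 1 1 inv_one (τ 1 h)) = W.ε h := by
  have key := congrArg χ (W.mul_antipodeTo_right 1 1 inv_one (one_mul 1).symm h)
  rw [map_smul, map_one, smul_eq_mul] at key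
  rw [← key.trans (mul_one _), hτ]
  generalize W.comulOf 1 1 1 _ h = t
  induction t with
  | zero => simp
  | add x y hx hy => simp only [map_add, hx, hy]
  | tmul x y => simp

lemma twist_antipodeTo_twist
    (hSr : ∀ p, lcast k (inv_inv p) (W.S p⁻¹ (r p⁻¹ : H p⁻¹)) = (((r p)⁻¹ : (H p)ˣ) : H p))
    (hτ : ∀ p h, τ p h = TensorProduct.lid k (H p)
      (map χ.toLinearMap LinearMap.id (W.comulOf 1 p p (one_mul p).symm h)))
    (hconj : ∀ p q s e h, W.comulOf p q s e (τ s h)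
      = map ((LinearMap.mulLeft k (r p : H p)).comp
          (LinearMap.mulRight k (((r p)⁻¹ : (H p)ˣ) : H p))) (τ q) (W.comulOf p q s e h))
    (hS : ∀ (p q : G) (h : H ((p * q)⁻¹)),
      W.Δ p q (lcast k (inv_inv (p * q)) (W.S (p * q)⁻¹ h))
        = map ((lcast k (inv_inv p)).comp (W.S p⁻¹)) ((lcast k (inv_inv q)).comp (W.S q⁻¹))
            (TensorProduct.comm k (H q⁻¹) (H p⁻¹)
              (W.Δ q⁻¹ p⁻¹ (lcast k (mul_inv_rev p q) h))))
    {p q : G} (e : p⁻¹ = q) (h : H p) :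
    τ q (W.antipodeTo p q e (τ p h))
      = r q * W.antipodeTo p q e h * (((r q)⁻¹ : (H q)ˣ) : H q) := by
  have hh : TensorProduct.rid k (H p) (map LinearMap.id W.ε.toLinearMap
      (W.comulOf p 1 p (mul_one p).symm h)) = h :=
    W.rid_map_counit_comulOf p p (mul_one p).symm h
  rw [hτ, W.comulOf_antipodeTo hS e inv_one e (mul_one p).symm, hconj]
  nth_rewrite 2 [← hh]
  generalize W.comulOf p 1 p _ h = t
  induction t with
  | zero => simp
  | add x y hx hy => simp only [map_add, hx, hy, mul_add, add_mul]
  | tmul x y =>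
    simp [antipodeTo_mul, W.antipodeTo_unit r hSr e, W.antipodeTo_unit_inv r hSr e,
      W.character_antipodeTo_twist χ τ hτ, mul_assoc]

lemma deriv_antipodeTo_twist
    (hSr : ∀ p, lcast k (inv_inv p) (W.S p⁻¹ (r p⁻¹ : H p⁻¹)) = (((r p)⁻¹ : (H p)ˣ) : H p))
    (hτ : ∀ p h, τ p h = TensorProduct.lid k (H p)
      (map χ.toLinearMap LinearMap.id (W.comulOf 1 p p (one_mul p).symm h)))
    (hder : ∀ (p : G) (a b : H p), δ p (a * b) = δ p a * b + τ p a * δ p b)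
    (hεδ : ∀ h : H 1, W.ε (δ 1 h) = 0)
    (hleft : ∀ p q s e h, W.comulOf p q s e (τ s h)
      = map (τ p) LinearMap.id (W.comulOf p q s e h))
    (hconj : ∀ p q s e h, W.comulOf p q s e (τ s h)
      = map ((LinearMap.mulLeft k (r p : H p)).comp
          (LinearMap.mulRight k (((r p)⁻¹ : (H p)ˣ) : H p))) (τ q) (W.comulOf p q s e h))
    (hδ : ∀ p q s e h, W.comulOf p q s e (δ s h)
      = map (δ p) LinearMap.id (W.comulOf p q s e h)
        + map (LinearMap.mulLeft k (r p : H p)) (δ q) (W.comulOf p q s e h))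
    (hS : ∀ (p q : G) (h : H ((p * q)⁻¹)),
      W.Δ p q (lcast k (inv_inv (p * q)) (W.S (p * q)⁻¹ h))
        = map ((lcast k (inv_inv p)).comp (W.S p⁻¹)) ((lcast k (inv_inv q)).comp (W.S q⁻¹))
            (TensorProduct.comm k (H q⁻¹) (H p⁻¹)
              (W.Δ q⁻¹ p⁻¹ (lcast k (mul_inv_rev p q) h))))
    {p q : G} (e : p⁻¹ = q) (h : H p) :
    r q * W.antipodeTo p q e (δ p h) = δ q (W.antipodeTo p q e (τ p h)) := by
  have e' : 1 = p * q := by rw [← e, mul_inv_cancel]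
  have hτ_one : τ q 1 = 1 := by simp [hτ, comulOf_one]
  have hδ_one : δ q 1 = 0 := by simpa [hτ_one] using hder q 1 1
  have hconv : ∀ x : H 1,
      LinearMap.mul' k (H q) (map (LinearMap.mulLeft k (r q : H q) ∘ₗ W.antipodeTo p q e ∘ₗ δ p)
          LinearMap.id (W.comulOf p q 1 e' x))
        = LinearMap.mul' k (H q) (map (δ q ∘ₗ W.antipodeTo p q e ∘ₗ τ p)
          LinearMap.id (W.comulOf p q 1 e' x)) := by
    intro x
    have hl := congrArg (fun y => (r q : H q) * y) (W.mul_antipodeTo_left p q e e' (δ 1 x))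
    have hr := congrArg (δ q) (W.mul_antipodeTo_left p q e e' (τ 1 x))
    simp only [hεδ, zero_smul, mul_zero, hδ, map_smul, hδ_one, smul_zero, hleft] at hl hr
    rw [← add_right_cancel_iff (a := LinearMap.mul' k (H q)
      (map (LinearMap.mulLeft k (r q : H q) ∘ₗ
          LinearMap.mulRight k (((r q)⁻¹ : (H q)ˣ) : H q) ∘ₗ W.antipodeTo p q e) (δ q)
        (W.comulOf p q 1 e' x)))]
    trans 0
    · rw [← hl]
      generalize W.comulOf p q 1 e' x = t
      induction t with
      | zero => simp
      | add x y hx hy =>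
        simp only [map_add, mul_add] at hx hy ⊢
        rw [add_add_add_comm, hx, hy, add_add_add_comm]
      | tmul x y =>
        simp [antipodeTo_mul, W.antipodeTo_unit r hSr e, mul_assoc, mul_add]
    · rw [← hr]
      generalize W.comulOf p q 1 e' x = t
      induction t with
      | zero => simp
      | add x y hx hy =>
        simp only [map_add] at hx hy ⊢
        rw [add_add_add_comm, hx, hy]
      | tmul x y =>
        simp [hder, W.twist_antipodeTo_twist χ r τ hSr hτ hconj hS e, mul_assoc]
  have hcancel : ∀ F : H p →ₗ[k] H q, F h
      = LinearMap.mul' k (H q) (map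
          (LinearMap.mul' k (H q) ∘ₗ map F LinearMap.id ∘ₗ W.comulOf p q 1 e')
          (W.antipodeTo p q e) (W.comulOf 1 p p (one_mul p).symm h)) := by
    intro F
    have := congrArg (fun t => LinearMap.mul' k (H q) (map F LinearMap.id t))
      (W.comulOf_mul_antipodeTo p q e e' h)
    simp only [map_tmul, LinearMap.id_coe, id_eq, LinearMap.mul'_apply, mul_one] at this
    rw [← this]
    generalize W.comulOf 1 p p _ h = t
    induction t with
    | zero => simp
    | add x y hx hy => simp only [map_add, hx, hy]
    | tmul x y =>
      simp only [map_tmul, LinearMap.comp_apply, LinearMap.id_coe, id_eq, LinearMap.mul'_apply]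
      generalize W.comulOf p q 1 e' x = u
      induction u with
      | zero => simp
      | add x y hx hy => simp only [map_add, add_tmul, add_mul, hx, hy]
      | tmul a b => simp [mul_assoc]
  have hl := hcancel (LinearMap.mulLeft k (r q : H q) ∘ₗ W.antipodeTo p q e ∘ₗ δ p)
  have hr := hcancel (δ q ∘ₗ W.antipodeTo p q e ∘ₗ τ p)
  refine hl.trans (Eq.trans ?_ hr.symm)
  congr 3
  exact LinearMap.ext hconv

end GCHCQG

/-- relation (3.20)/(3.21): Under the hypotheses of Theorem 4.3
(sufficiency), for every `p ∈ G` and `h ∈ H_p`: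
`r_{p⁻¹}·S_p(δ_p(h)) = χ(h_(1,1))·δ_{p⁻¹}(S_p(h_(2,p))) = δ_{p⁻¹}(S_p(τ_p(h)))`. -/
theorem statement15 (k : Type*) [Field k] {G : Type*} [Group G]
    (H : G → Type*) [∀ p, Ring (H p)] [∀ p, Algebra k (H p)]
    (W : GCHCQG k H)
    (χ : H (1 : G) →ₐ[k] k)
    (r : ∀ p : G, (H p)ˣ)
    (hSr : ∀ p : G,
      lcast k (inv_inv p) (W.S p⁻¹ ((r p⁻¹ : H p⁻¹))) = (((r p)⁻¹ : (H p)ˣ) : H p))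
    (τ : ∀ p : G, H p →ₗ[k] H p)
    (hτ : ∀ (p : G) (h : H p),
      τ p h
        = TensorProduct.lid k (H p)
            (TensorProduct.map χ.toLinearMap LinearMap.id
              (W.Δ 1 p (lcast k (one_mul p).symm h))))
    (δ : ∀ p : G, H p →ₗ[k] H p)
    (hder : ∀ (p : G) (a b : H p), δ p (a * b) = δ p a * b + τ p a * δ p b)
    (hεδ : ∀ h : H (1 : G), W.ε (δ 1 h) = 0)
    (hD2 : ∀ (p q : G) (h : H (p * q)),
      (TensorProduct.lid k (H p ⊗[k] H q)
          (TensorProduct.map χ.toLinearMap (W.Δ p q).toLinearMap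
            (W.Δ 1 (p * q) (lcast k (one_mul (p * q)).symm h)))
        = TensorProduct.map
            ((LinearMap.mulLeft k ((r p : H p))).comp
              (LinearMap.mulRight k (((r p)⁻¹ : (H p)ˣ) : H p)))
            ((TensorProduct.lid k (H q)).toLinearMap ∘ₗ
              TensorProduct.map χ.toLinearMap LinearMap.id ∘ₗ
              (W.Δ 1 q).toLinearMap ∘ₗ lcast k (one_mul q).symm)
            (W.Δ p q h)) ∧
      (TensorProduct.map
            ((LinearMap.mulLeft k ((r p : H p))).comp
              (LinearMap.mulRight k (((r p)⁻¹ : (H p)ˣ) : H p)))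
            ((TensorProduct.lid k (H q)).toLinearMap ∘ₗ
              TensorProduct.map χ.toLinearMap LinearMap.id ∘ₗ
              (W.Δ 1 q).toLinearMap ∘ₗ lcast k (one_mul q).symm)
            (W.Δ p q h)
        = TensorProduct.map
            ((TensorProduct.lid k (H p)).toLinearMap ∘ₗ
              TensorProduct.map χ.toLinearMap LinearMap.id ∘ₗ
              (W.Δ 1 p).toLinearMap ∘ₗ lcast k (one_mul p).symm)
            LinearMap.id (W.Δ p q h)))
    (hD3 : ∀ (p q : G) (h : H (p * q)),
      W.Δ p q (δ (p * q) h)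
        = TensorProduct.map (δ p) LinearMap.id (W.Δ p q h)
          + TensorProduct.map (LinearMap.mulLeft k ((r p : H p))) (δ q) (W.Δ p q h))
    (hS : ∀ (p q : G) (h : H ((p * q)⁻¹)),
      W.Δ p q (lcast k (inv_inv (p * q)) (W.S (p * q)⁻¹ h))
        = TensorProduct.map
            ((lcast k (inv_inv p)).comp (W.S p⁻¹))
            ((lcast k (inv_inv q)).comp (W.S q⁻¹))
            (TensorProduct.comm k (H q⁻¹) (H p⁻¹)
              (W.Δ q⁻¹ p⁻¹ (lcast k (mul_inv_rev p q) h)))) :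
    ∀ (p : G) (h : H p),
      ((r p⁻¹ : H p⁻¹) * W.S p (δ p h)
        = TensorProduct.lid k (H p⁻¹)
            (TensorProduct.map χ.toLinearMap ((δ p⁻¹).comp (W.S p))
              (W.Δ 1 p (lcast k (one_mul p).symm h)))) ∧
      (TensorProduct.lid k (H p⁻¹)
            (TensorProduct.map χ.toLinearMap ((δ p⁻¹).comp (W.S p))
              (W.Δ 1 p (lcast k (one_mul p).symm h)))
        = δ p⁻¹ (W.S p (τ p h))) := by
  have htw : ∀ p, (TensorProduct.lid k (H p)).toLinearMap ∘ₗ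
      TensorProduct.map χ.toLinearMap LinearMap.id ∘ₗ
      (W.Δ 1 p).toLinearMap ∘ₗ lcast k (one_mul p).symm = τ p :=
    fun p => LinearMap.ext fun h => (hτ p h).symm
  simp only [htw] at hD2
  have hleft : ∀ p q s e h, W.comulOf p q s e (τ s h)
      = TensorProduct.map (τ p) LinearMap.id (W.comulOf p q s e h) := by
    intro p q s e h
    subst e
    refine Eq.trans ?_ ((hD2 p q h).1.trans (hD2 p q h).2)
    rw [hτ]
    change W.Δ p q _ = _
    generalize W.Δ 1 (p * q) _ = t
    induction t with
    | zero => simp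
    | add x y hx hy => simp only [map_add, hx, hy]
    | tmul x y =>
      simp only [TensorProduct.map_tmul, TensorProduct.lid_tmul, map_smul]
      rfl
  have hδ : ∀ p q s e h, W.comulOf p q s e (δ s h)
      = TensorProduct.map (δ p) LinearMap.id (W.comulOf p q s e h)
        + TensorProduct.map (LinearMap.mulLeft k (r p : H p)) (δ q) (W.comulOf p q s e h) := by
    intro p q s e h
    subst e
    exact hD3 p q h
  have hsecond : ∀ (p : G) (h : H p),
      TensorProduct.lid k (H p⁻¹)
          (TensorProduct.map χ.toLinearMap ((δ p⁻¹).comp (W.S p))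
            (W.Δ 1 p (lcast k (one_mul p).symm h)))
        = δ p⁻¹ (W.S p (τ p h)) := by
    intro p h
    rw [hτ]
    generalize W.Δ 1 p _ = t
    induction t with
    | zero => simp
    | add x y hx hy => simp only [map_add, hx, hy]
    | tmul x y => simp
  intro p h
  refine ⟨Eq.trans ?_ (hsecond p h).symm, hsecond p h⟩
  refine W.deriv_antipodeTo_twist χ r τ δ hSr hτ hder hεδ hleft ?_ hδ hS rfl h
  intro p q s e h
  rw [hleft]
  subst e
  exact (hD2 p q h).2.symm
end
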